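/- arXiv:2601.04784 — 7 statements merged into one kernel-verified Lean document; each statement's English description precedes it below -/
import Mathlib

section
/- Let d ≥ 1 and let V : ℝ^d → ℝ be a C^∞ function. Assume there exist C > 0 and a compact set K ⊂ ℝ^d such that for all x ∈ ℝ^d \ K one has V(x) ≥ −C, |∇V(x)| ≥ 1/C and ‖Hess V(x)‖ ≤ C. Then there exists b ∈ ℝ such that for all x ∈ ℝ^d, V(x) ≥ |x|/C + b. -/
open Filter Topology Set in
/-- Let `d ≥ 1` and let `V : ℝ^d → ℝ` be a `C^∞` function. Assume there exist
`C > 0` and a compact set `K ⊂ ℝ^d` such that for all `x ∈ ℝ^d \ K` one has `V x ≥ -C`,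
`|∇V x| ≥ 1/C` and `‖Hess V x‖ ≤ C`. Then there exists `b ∈ ℝ` such that for all `x`,
`V x ≥ |x|/C + b`. -/
theorem stmt0 (d : ℕ) (hd : 1 ≤ d) (V : EuclideanSpace ℝ (Fin d) → ℝ)
    (hV : ContDiff ℝ (⊤ : ℕ∞) V)
    (C : ℝ) (hC : 0 < C) (K : Set (EuclideanSpace ℝ (Fin d))) (hK : IsCompact K)
    (hVlb : ∀ x ∉ K, -C ≤ V x)
    (hgrad : ∀ x ∉ K, 1 / C ≤ ‖gradient V x‖)
    (hHess : ∀ x ∉ K, ‖iteratedFDeriv ℝ 2 V x‖ ≤ C) :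
    ∃ b : ℝ, ∀ x : EuclideanSpace ℝ (Fin d), ‖x‖ / C + b ≤ V x := by
  obtain ⟨R, hR⟩ := hK.isBounded.exists_norm_le
  obtain ⟨m₀, hm₀⟩ := (hK.image hV.continuous).bddBelow
  have hdiff : Differentiable ℝ V := hV.differentiable (by simp)
  obtain ⟨m, hm⟩ : ∃ m, ∀ x, m ≤ V x := by
    refine ⟨min m₀ (-C), fun x => ?_⟩
    by_cases hx : x ∈ K
    · exact (min_le_left _ _).trans (hm₀ ⟨x, hx, rfl⟩)
    · exact (min_le_right _ _).trans (hVlb x hx)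
  refine ⟨m - R / C, fun x => ?_⟩
  -- the Ekeland-type argument with a slope `l < 1 / C`
  have key : ∀ l : ℝ, 0 < l → l < 1 / C → m + l * (‖x‖ - R) ≤ V x := by
    intro l hl0 hl
    obtain ⟨y, hy⟩ : ∃ y, ∀ z, V y + l * dist z y ≥ V y ∧
        V y + l * dist y x ≤ V z + l * dist z x := by
      have hcont : Continuous fun z => V z + l * dist z x :=
        hV.continuous.add (by fun_prop)
      have hlim : Tendsto (fun z => V z + l * dist z x)
          (cocompact (EuclideanSpace ℝ (Fin d))) atTop :=
        tendsto_atTop_add_left_of_le _ m hm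
          ((tendsto_dist_right_cocompact_atTop x).const_mul_atTop hl0)
      obtain ⟨y, hy⟩ := hcont.exists_forall_le hlim
      refine ⟨y, fun z => ⟨?_, hy z⟩⟩
      have : 0 ≤ l * dist z y := by positivity
      linarith
    have hyK : y ∈ K := by
      by_contra hyK
      have hg := hgrad y hyK
      set g := gradient V y with hgdef
      have hgpos : 0 < ‖g‖ := lt_of_lt_of_le (by positivity) hg
      have hgr : HasGradientAt V g y := (hdiff y).hasGradientAt
      have hline : HasDerivAt (fun t : ℝ => y - t • g) (-g) 0 := by
        simpa using ((hasDerivAt_id (0 : ℝ)).smul_const g).const_sub y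
      have hF : HasFDerivAt V (InnerProductSpace.toDual ℝ _ g) (y - (0 : ℝ) • g) := by
        simpa using hgr.hasFDerivAt
      have hcomp := hF.comp_hasDerivAt (0 : ℝ) hline
      have hphi := hcomp.tendsto_slope_zero_right
      have hle : -(l * ‖g‖) ≤ (InnerProductSpace.toDual ℝ _ g) (-g) := by
        refine ge_of_tendsto hphi ?_
        filter_upwards [self_mem_nhdsWithin] with t ht
        have ht : (0 : ℝ) < t := ht
        have h1 := (hy (y - t • g)).2
        have h2 : dist (y - t • g) x ≤ t * ‖g‖ + dist y x := by
          refine (dist_triangle _ y _).trans (le_of_eq ?_)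
          simp [dist_eq_norm, norm_smul, abs_of_pos ht]
        have h3 : l * dist (y - t • g) x ≤ l * (t * ‖g‖ + dist y x) :=
          mul_le_mul_of_nonneg_left h2 hl0.le
        simp only [Function.comp, zero_add, zero_smul, sub_zero, smul_eq_mul]
        rw [inv_mul_eq_div, le_div_iff₀ ht]
        nlinarith
      rw [map_neg, InnerProductSpace.toDual_apply_apply, real_inner_self_eq_norm_sq] at hle
      nlinarith
    have h1 := (hy x).2
    rw [dist_self] at h1
    have h2 := hm y
    have h3 := hR y hyK
    have h4 : ‖x‖ - R ≤ dist y x := by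
      rw [dist_comm, dist_eq_norm]
      linarith [norm_sub_norm_le x y]
    nlinarith
  have hlim : Tendsto (fun l : ℝ => m + l * (‖x‖ - R)) (𝓝[<] (1 / C))
      (𝓝 (m + 1 / C * (‖x‖ - R))) := by
    apply Tendsto.mono_left _ nhdsWithin_le_nhds
    exact Continuous.tendsto (by fun_prop) _
  have hfin : m + 1 / C * (‖x‖ - R) ≤ V x := by
    refine le_of_tendsto hlim ?_
    have hpos : (0 : ℝ) < 1 / C := by positivity
    filter_upwards [Ioo_mem_nhdsLT hpos] with l hl
    exact key l hl.1 hl.2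
  calc ‖x‖ / C + (m - R / C) = m + 1 / C * (‖x‖ - R) := by ring
    _ ≤ V x := hfin
end

section
/- Let d ≥ 1 and let V : ℝ^d → ℝ be a C^∞ function with V(x) ≥ 0 for all x, and suppose there exist R > 0 and C > 0 such that |∇V(x)| ≥ 1/C whenever |x| ≥ R. Then for every λ ≥ 0 the sublevel set {x ∈ ℝ^d : V(x) ≤ λ} is contained in the closed Euclidean ball of center 0 and radius R + λC. -/
/-- Let `d ≥ 1` and `V : ℝ^d → ℝ` be `C^∞`, nonnegative, and suppose there exist
`R > 0`, `C > 0` with `|∇V x| ≥ 1/C` whenever `|x| ≥ R`. Then for every `λ ≥ 0` the sublevel set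
`{V ≤ λ}` is contained in the closed ball of center `0` and radius `R + λC`. -/
theorem stmt1 (d : ℕ) (hd : 1 ≤ d) (V : EuclideanSpace ℝ (Fin d) → ℝ)
    (hV : ContDiff ℝ (⊤ : ℕ∞) V) (hV0 : ∀ x, 0 ≤ V x)
    (R C : ℝ) (hR : 0 < R) (hC : 0 < C)
    (hgrad : ∀ x : EuclideanSpace ℝ (Fin d), R ≤ ‖x‖ → 1 / C ≤ ‖gradient V x‖)
    (lam : ℝ) (hlam : 0 ≤ lam) :
    {x : EuclideanSpace ℝ (Fin d) | V x ≤ lam} ⊆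
      Metric.closedBall (0 : EuclideanSpace ℝ (Fin d)) (R + lam * C) := by
  intro x hx
  simp only [Set.mem_setOf_eq] at hx
  rw [mem_closedBall_zero_iff]
  by_contra! hlt
  obtain ⟨r, hr⟩ : ∃ r, r = ‖x‖ - R := ⟨_, rfl⟩
  have hlr : lam * C < r := by linarith
  have hr0 : 0 < r := lt_of_le_of_lt (by positivity) hlr
  obtain ⟨a, ha1, ha2⟩ : ∃ a, lam / r < a ∧ a < 1 / C := by
    apply exists_between
    rw [div_lt_div_iff₀ hr0 hC]
    linarith
  have ha0 : 0 < a := lt_of_le_of_lt (by positivity) ha1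
  have har : lam < a * r := by rwa [div_lt_iff₀ hr0] at ha1
  -- minimise `V z + a * ‖z - x‖` on the closed ball of radius `r` around `x`
  obtain ⟨y, hy, hmin⟩ := (isCompact_closedBall x r).exists_isMinOn
    ⟨x, Metric.mem_closedBall_self hr0.le⟩
    (f := fun z => V z + a * ‖z - x‖)
    ((hV.continuous.add (by fun_prop)).continuousOn)
  have hyx : V y + a * ‖y - x‖ ≤ V x := by
    have := hmin (Metric.mem_closedBall_self hr0.le)
    simpa using this
  have hyr : ‖y - x‖ < r := by
    have h0 := hV0 y
    by_contra! h
    nlinarith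
  have hyR : R ≤ ‖y‖ := by
    have := norm_sub_norm_le x y
    rw [norm_sub_rev] at this
    linarith
  have hg := hgrad y hyR
  obtain ⟨g, hgd⟩ : ∃ g, g = gradient V y := ⟨_, rfl⟩
  rw [← hgd] at hg
  have hdiff : DifferentiableAt ℝ V y := (hV.differentiable (by simp)) y
  have hG := hdiff.hasGradientAt.hasFDerivAt
  rw [← hgd] at hG
  have hline : HasDerivAt (fun t : ℝ => y - t • g) (-g) 0 := by
    have := ((hasDerivAt_id (0 : ℝ)).smul_const g).const_sub y
    simpa using this
  have hφ : HasDerivAt (fun t : ℝ => V (y - t • g)) (-(‖g‖ ^ 2)) 0 := by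
    have h1 : HasFDerivAt V (InnerProductSpace.toDual ℝ _ g) (y - (0 : ℝ) • g) := by
      simpa using hG
    have := h1.comp_hasDerivAt (0 : ℝ) hline
    simpa [Function.comp_def] using this
  have hev : ∀ᶠ t : ℝ in nhds 0, y - t • g ∈ Metric.ball x r := by
    apply hline.continuousAt.eventually_mem
    apply Metric.isOpen_ball.mem_nhds
    simpa [dist_eq_norm] using hyr
  have hkey : -(a * ‖g‖) ≤ -(‖g‖ ^ 2) := by
    refine ge_of_tendsto hφ.tendsto_slope_zero_right ?_
    filter_upwards [nhdsWithin_le_nhds hev, self_mem_nhdsWithin] with t ht ht0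
    have ht0 : 0 < t := ht0
    have h1 : V y + a * ‖y - x‖ ≤ V (y - t • g) + a * ‖y - t • g - x‖ :=
      hmin (Metric.ball_subset_closedBall ht)
    have h2 : ‖y - t • g - x‖ ≤ ‖y - x‖ + t * ‖g‖ := by
      have : y - t • g - x = (y - x) - t • g := by abel
      rw [this]
      refine (norm_sub_le _ _).trans ?_
      rw [norm_smul, Real.norm_of_nonneg ht0.le]
    have h3 := mul_le_mul_of_nonneg_left h2 ha0.le
    simp only [zero_add, zero_smul, sub_zero, smul_eq_mul]
    rw [inv_mul_eq_div, le_div_iff₀ ht0]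
    nlinarith
  have hgpos : 0 < ‖g‖ := lt_of_lt_of_le (by positivity) hg
  nlinarith
end

section
/- Let n ≥ 1 and let W : ℝ^n → ℝ be a C^∞ function. Let s ∈ ℝ^n and assume W admits the degenerate normal form at s: there exist an open neighborhood 𝒱 of s, a C^∞ diffeomorphism U from 𝒱 onto an open neighborhood of s with U(s) = s and d_sU invertible, nonzero reals t₁,…,t_n, and integers ν₁,…,ν_n ≥ 2 such that W(U(x)) − W(s) = Σ_{i=1}^n t_i (x_i − s_i)^{ν_i} for all x ∈ 𝒱. Assume moreover that every ν_i is even and that exactly one of the t_i is negative. Then there exists r₀ > 0 such that for every 0 < r < r₀, the open set B(s,r) ∩ {x ∈ ℝ^n : W(x) < W(s)} has exactly two connected components. -/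
open Set Filter Topology in
theorem card_two_aux {X : Type*} [TopologicalSpace X] (A : Set X) (hA : IsClopen A)
    (h1 : IsPreconnected A) (h2 : IsPreconnected Aᶜ) (n1 : A.Nonempty) (n2 : Aᶜ.Nonempty) :
    Nat.card (ConnectedComponents X) = 2 := by
  obtain ⟨a, ha⟩ := n1
  obtain ⟨b, hb⟩ := n2
  rw [Nat.card_eq_two_iff]
  refine ⟨(a : ConnectedComponents X), (b : ConnectedComponents X), ?_, ?_⟩
  · intro h
    rw [ConnectedComponents.coe_eq_coe'] at h
    exact hA.compl.connectedComponent_subset hb h ha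
  · rw [Set.eq_univ_iff_forall]
    intro z
    obtain ⟨z, rfl⟩ := ConnectedComponents.surjective_coe z
    by_cases hz : z ∈ A
    · left
      rw [ConnectedComponents.coe_eq_coe']
      exact h1.subset_connectedComponent ha hz
    · right
      rw [Set.mem_singleton_iff, ConnectedComponents.coe_eq_coe']
      exact h2.subset_connectedComponent hb hz

theorem norm_mono_aux {n : ℕ} (x y : EuclideanSpace ℝ (Fin n)) (h : ∀ i, |x i| ≤ |y i|) :
    ‖x‖ ≤ ‖y‖ := by
  rw [EuclideanSpace.norm_eq, EuclideanSpace.norm_eq]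
  apply Real.sqrt_le_sqrt
  apply Finset.sum_le_sum
  intro i _
  rw [Real.norm_eq_abs, Real.norm_eq_abs]
  exact pow_le_pow_left₀ (abs_nonneg _) (h i) 2

theorem norm_le_aux {n : ℕ} (x : EuclideanSpace ℝ (Fin n)) (B : ℝ) (hB : 0 ≤ B)
    (h : ∀ i, |x i| ≤ B) : ‖x‖ ≤ n * B := by
  rw [EuclideanSpace.norm_eq]
  apply Real.sqrt_le_iff.2
  refine ⟨by positivity, ?_⟩
  calc ∑ i, ‖x i‖ ^ 2 ≤ ∑ i : Fin n, B ^ 2 := by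
        apply Finset.sum_le_sum
        intro i _
        exact pow_le_pow_left₀ (norm_nonneg _) (h i) 2
    _ = n * B ^ 2 := by simp
    _ ≤ (n * B) ^ 2 := by
        rw [mul_pow]
        apply mul_le_mul_of_nonneg_right _ (sq_nonneg B)
        exact_mod_cast Nat.le_self_pow (by norm_num) n

/-- On the sublevel set, the coordinates of low exponent are small. -/
theorem small_aux {n : ℕ} (t : Fin n → ℝ) (ν : Fin n → ℕ) (hν : ∀ i, 2 ≤ ν i)
    (heven : ∀ i, Even (ν i)) (i0 : Fin n) (h0 : t i0 < 0) (hpos : ∀ i, i ≠ i0 → 0 < t i)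
    (η R : ℝ) (hη : 0 < η) (hR1 : R ≤ 1) (hR : ∀ i, i ≠ i0 → -t i0 * R ≤ t i * η ^ ν i)
    (y : EuclideanSpace ℝ (Fin n)) (hy : ‖y‖ ≤ R) (hf : ∑ i, t i * y i ^ ν i < 0)
    (i : Fin n) (hi : ν i < ν i0) : |y i| ≤ η * ‖y‖ := by
  have hne : i ≠ i0 := by rintro rfl; exact lt_irrefl _ hi
  have hYi : ∀ j, |y j| ≤ ‖y‖ := fun j => PiLp.norm_apply_le y j
  have hY := norm_nonneg y
  rw [← Finset.add_sum_erase _ _ (Finset.mem_univ i0)] at hf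
  have h1 : t i * y i ^ ν i ≤ ∑ j ∈ Finset.univ.erase i0, t j * y j ^ ν j := by
    apply Finset.single_le_sum (f := fun j => t j * y j ^ ν j)
    · intro j hj
      exact mul_nonneg (hpos j (Finset.ne_of_mem_erase hj)).le ((heven j).pow_nonneg _)
    · simp [hne]
  have h2 : y i0 ^ ν i0 ≤ ‖y‖ * ‖y‖ ^ ν i := by
    rw [← (heven i0).pow_abs]
    calc |y i0| ^ ν i0 ≤ ‖y‖ ^ ν i0 := pow_le_pow_left₀ (abs_nonneg _) (hYi _) _
      _ ≤ ‖y‖ ^ (ν i + 1) := pow_le_pow_of_le_one hY (hy.trans hR1) hi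
      _ = _ := by ring
  have h3 : t i * |y i| ^ ν i ≤ t i * (η * ‖y‖) ^ ν i := by
    rw [(heven i).pow_abs]
    calc t i * y i ^ ν i ≤ -t i0 * y i0 ^ ν i0 := by linarith
      _ ≤ -t i0 * (‖y‖ * ‖y‖ ^ ν i) := mul_le_mul_of_nonneg_left h2 (by linarith)
      _ = (-t i0 * ‖y‖) * ‖y‖ ^ ν i := by ring
      _ ≤ (-t i0 * R) * ‖y‖ ^ ν i := by
          apply mul_le_mul_of_nonneg_right _ (by positivity)
          exact mul_le_mul_of_nonneg_left hy (by linarith)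
      _ ≤ (t i * η ^ ν i) * ‖y‖ ^ ν i :=
          mul_le_mul_of_nonneg_right (hR i hne) (by positivity)
      _ = _ := by rw [mul_pow]; ring
  have h4 := le_of_mul_le_mul_left h3 (hpos i hne)
  exact le_of_pow_le_pow_left₀ (by have := hν i; omega) (by positivity) h4

/-- The anisotropic contraction. -/
noncomputable def contr {n : ℕ} (κ : Fin n → ℝ) (y : EuclideanSpace ℝ (Fin n)) (τ : ℝ) :
    EuclideanSpace ℝ (Fin n) := WithLp.toLp 2 fun i => Real.exp (-(κ i * τ)) * y i

theorem contr_hasDerivAt {n : ℕ} (κ : Fin n → ℝ) (y : EuclideanSpace ℝ (Fin n)) (τ : ℝ) :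
    HasDerivAt (contr κ y) (-(WithLp.toLp 2 fun i => κ i * contr κ y τ i)) τ := by
  rw [hasDerivAt_iff_hasFDerivAt, ← hasFDerivWithinAt_univ, hasFDerivWithinAt_euclidean]
  intro i
  rw [hasFDerivWithinAt_univ]
  have h : HasDerivAt (fun τ : ℝ => Real.exp (-(κ i * τ)) * y i)
      (Real.exp (-(κ i * τ)) * (-(κ i * 1)) * y i) τ :=
    ((((hasDerivAt_id τ).const_mul (κ i)).neg).exp).mul_const _
  have h' := h.hasFDerivAt
  refine h'.congr_fderiv ?_
  refine ContinuousLinearMap.ext fun u => ?_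
  simp only [ContinuousLinearMap.toSpanSingleton_apply, ContinuousLinearMap.comp_apply, contr,
    PiLp.proj_apply, PiLp.smul_apply, PiLp.neg_apply, smul_eq_mul]
  ring

theorem contr_bound {n : ℕ} (κ : Fin n → ℝ) (hκ : ∀ i, 1 ≤ κ i) (y : EuclideanSpace ℝ (Fin n))
    (τ : ℝ) (hτ : 0 ≤ τ) : ‖contr κ y τ‖ ≤ Real.exp (-τ) * ‖y‖ := by
  have : Real.exp (-τ) * ‖y‖ = ‖Real.exp (-τ) • y‖ := by
    rw [norm_smul, Real.norm_eq_abs, abs_of_pos (Real.exp_pos _)]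
  rw [this]
  apply norm_mono_aux
  intro i
  simp only [contr, PiLp.smul_apply, smul_eq_mul, abs_mul, Real.abs_exp]
  apply mul_le_mul_of_nonneg_right _ (abs_nonneg _)
  apply Real.exp_le_exp.2
  nlinarith [hκ i]

theorem core_aux {n : ℕ} (t : Fin n → ℝ) (ν : Fin n → ℕ) (hν : ∀ i, 2 ≤ ν i)
    (heven : ∀ i, Even (ν i)) (i0 : Fin n) (h0 : t i0 < 0) (hpos : ∀ i, i ≠ i0 → 0 < t i)
    (φ : EuclideanSpace ℝ (Fin n) → EuclideanSpace ℝ (Fin n))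
    (φ' : EuclideanSpace ℝ (Fin n) → EuclideanSpace ℝ (Fin n) →L[ℝ] EuclideanSpace ℝ (Fin n))
    (hφ0 : φ 0 = 0) (η' R : ℝ) (hη' : 0 < η') (hR0 : 0 < R)
    (hd : ∀ y, ‖y‖ < R → HasFDerivAt φ (φ' y) y)
    (hm : ∀ y w, ‖y‖ < R → ‖w - y‖ ≤ η' * ‖y‖ → 0 ≤ inner ℝ (φ y) (φ' y w)) :
    ∃ R' > 0, R' ≤ R ∧ ∀ r > 0, ∀ σ : ℝ, (σ = 1 ∨ σ = -1) →
      IsPathConnected {y : EuclideanSpace ℝ (Fin n) |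
        ‖y‖ < R' ∧ ‖φ y‖ < r ∧ ∑ i, t i * y i ^ ν i < 0 ∧ 0 < σ * y i0} := by
  have hn : 0 < n := i0.pos
  have hnR : (0:ℝ) < n := by exact_mod_cast hn
  have hν0 : (0:ℝ) < ν i0 := by have := hν i0; exact_mod_cast (by omega : 0 < ν i0)
  set η : ℝ := η' / (n * ν i0) with hηdef
  have hη : 0 < η := by positivity
  have hev : ∀ᶠ R' : ℝ in nhdsWithin 0 (Set.Ioi 0), 0 < R' ∧ R' ≤ R ∧ R' ≤ 1 ∧
      ∀ i, i ≠ i0 → -t i0 * R' ≤ t i * η ^ ν i := by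
    refine Filter.Eventually.and self_mem_nhdsWithin (Filter.Eventually.and ?_
      (Filter.Eventually.and ?_ ?_))
    · exact nhdsWithin_le_nhds (eventually_le_nhds hR0)
    · exact nhdsWithin_le_nhds (eventually_le_nhds one_pos)
    · rw [Filter.eventually_all]
      intro i
      by_cases hi : i = i0
      · simp [hi]
      have hc : Filter.Tendsto (fun R' : ℝ => -t i0 * R') (nhds 0) (nhds 0) := by
        have : Continuous (fun R' : ℝ => -t i0 * R') := by fun_prop
        simpa using this.tendsto 0
      have : 0 < t i * η ^ ν i := mul_pos (hpos i hi) (by positivity)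
      filter_upwards [nhdsWithin_le_nhds (hc.eventually (eventually_le_nhds this))] with x hx _
      exact hx
  obtain ⟨R', hR'0, hR'R, hR'1, hR'⟩ := hev.exists
  refine ⟨R', hR'0, hR'R, ?_⟩
  intro r hr σ hσ
  have hσ2 : σ * σ = 1 := by rcases hσ with rfl | rfl <;> norm_num
  have hσa : |σ| = 1 := by rcases hσ with rfl | rfl <;> norm_num
  set S := {y : EuclideanSpace ℝ (Fin n) |
        ‖y‖ < R' ∧ ‖φ y‖ < r ∧ ∑ i, t i * y i ^ ν i < 0 ∧ 0 < σ * y i0} with hS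
  -- small ball
  have hcont0 : ContinuousAt φ 0 := (hd 0 (by simpa using hR0)).continuousAt
  obtain ⟨ε, hε, hεR, hεr⟩ : ∃ ε > 0, ε ≤ R' ∧ ∀ y, ‖y‖ < ε → ‖φ y‖ < r := by
    obtain ⟨δ, hδ, h⟩ := Metric.continuousAt_iff.1 hcont0 r hr
    refine ⟨min δ R', lt_min hδ hR'0, min_le_right _ _, ?_⟩
    intro y hy
    have := @h y (by simpa using lt_of_lt_of_le hy (min_le_left _ _))
    simpa [hφ0] using this
  -- axis points
  have haxis : ∀ b : ℝ, 0 < σ * b → |b| < ε → EuclideanSpace.single i0 b ∈ S := by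
    intro b hb hbε
    have hn : ‖(EuclideanSpace.single i0 b : EuclideanSpace ℝ (Fin n))‖ < ε := by simpa using hbε
    refine ⟨hn.trans_le hεR, hεr _ hn, ?_, by simpa using hb⟩
    rw [Finset.sum_eq_single i0]
    · simp only [PiLp.single_apply, if_true]
      have hb0 : b ≠ 0 := by rintro rfl; simp at hb
      exact mul_neg_of_neg_of_pos h0 ((heven i0).pow_pos hb0)
    · intro j _ hj
      have := hν j
      simp [hj, show ν j ≠ 0 by omega]
    · simp
  -- near points to axis
  have hnear : ∀ y ∈ S, ‖y‖ < ε → JoinedIn S y (EuclideanSpace.single i0 (y i0)) := by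
    intro y hy hyε
    apply JoinedIn.of_segment_subset
    rw [segment_eq_image_lineMap]
    rintro _ ⟨u, hu, rfl⟩
    set z := AffineMap.lineMap y (EuclideanSpace.single i0 (y i0) : EuclideanSpace ℝ (Fin n)) u
      with hz
    have hz0 : z i0 = y i0 := by simp [hz, AffineMap.lineMap_apply]
    have hzi : ∀ i, i ≠ i0 → z i = (1 - u) * y i := by
      intro i hi; simp [hz, AffineMap.lineMap_apply, hi]; ring
    have habs : ∀ i, |z i| ≤ |y i| := by
      intro i
      by_cases hi : i = i0
      · rw [hi, hz0]
      · rw [hzi i hi, abs_mul, abs_of_nonneg (by linarith [hu.2])]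
        exact mul_le_of_le_one_left (abs_nonneg _) (by linarith [hu.1])
    have hzn := norm_mono_aux z y habs
    refine ⟨hzn.trans_lt hy.1, hεr _ (hzn.trans_lt hyε), ?_, by rw [hz0]; exact hy.2.2.2⟩
    refine lt_of_le_of_lt ?_ hy.2.2.1
    apply Finset.sum_le_sum
    intro i _
    by_cases hi : i = i0
    · rw [hi, hz0]
    · apply mul_le_mul_of_nonneg_left _ (hpos i hi).le
      rw [← (heven i).pow_abs, ← (heven i).pow_abs (y i)]
      exact pow_le_pow_left₀ (abs_nonneg _) (habs i) _
  -- flow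
  let κ : Fin n → ℝ := fun i => max 1 ((ν i0 : ℝ) / ν i)
  have hνi : ∀ i, (2:ℝ) ≤ ν i := fun i => by exact_mod_cast hν i
  have hκ1 : ∀ i, 1 ≤ κ i := fun i => le_max_left _ _
  have hκ0 : κ i0 = 1 := by simp [κ, div_self hν0.ne']
  have hκν : ∀ i, (ν i0 : ℝ) ≤ κ i * ν i := by
    intro i
    rw [← div_le_iff₀ (by linarith [hνi i])]
    exact le_max_right _ _
  have hκle : ∀ i, κ i ≤ ν i0 := by
    intro i
    apply max_le (by linarith [hνi i0])
    exact div_le_self hν0.le (by linarith [hνi i])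
  have hκeq : ∀ i, ν i0 ≤ ν i → κ i = 1 := by
    intro i hi
    apply max_eq_left
    rw [div_le_one (by linarith [hνi i])]
    exact_mod_cast hi
  have hfl : ∀ y ∈ S, ∀ τ : ℝ, 0 ≤ τ → ‖contr κ y τ‖ ≤ ‖y‖ ∧
      ∑ i, t i * contr κ y τ i ^ ν i < 0 ∧ 0 < σ * contr κ y τ i0 := by
    intro y hy τ hτ
    refine ⟨(contr_bound κ hκ1 y τ hτ).trans (mul_le_of_le_one_left (norm_nonneg _)
      (Real.exp_le_one_iff.2 (by linarith))), ?_, ?_⟩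
    · have : ∑ i, t i * contr κ y τ i ^ ν i ≤
          Real.exp (-(ν i0 * τ)) * ∑ i, t i * y i ^ ν i := by
        rw [Finset.mul_sum]
        apply Finset.sum_le_sum
        intro i _
        have e1 : contr κ y τ i ^ ν i = Real.exp (-(κ i * ν i * τ)) * y i ^ ν i := by
          simp only [contr]
          rw [mul_pow, ← Real.exp_nat_mul]
          congr 2; ring
        rw [e1]
        by_cases hi : i = i0
        · subst hi; rw [hκ0, one_mul]; apply le_of_eq; ring
        · have : Real.exp (-(κ i * ν i * τ)) ≤ Real.exp (-(ν i0 * τ)) :=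
            Real.exp_le_exp.2 (by nlinarith [hκν i])
          have h5 : 0 ≤ t i * y i ^ ν i := mul_nonneg (hpos i hi).le ((heven i).pow_nonneg _)
          nlinarith [mul_le_mul_of_nonneg_right this h5]
      exact this.trans_lt (mul_neg_of_pos_of_neg (Real.exp_pos _) hy.2.2.1)
    · simp only [contr]
      have := mul_pos (Real.exp_pos (-(κ i0 * τ))) hy.2.2.2
      linarith [this]
  have hflS : ∀ y ∈ S, ∀ τ : ℝ, 0 ≤ τ → contr κ y τ ∈ S := by
    intro y hy τ hτ
    have hnR' : ∀ τ : ℝ, 0 ≤ τ → ‖contr κ y τ‖ < R' := fun τ hτ =>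
      (hfl y hy τ hτ).1.trans_lt hy.1
    have hder : ∀ τ : ℝ, 0 ≤ τ → HasDerivAt (fun τ => ‖φ (contr κ y τ)‖ ^ 2)
        (2 * inner ℝ (φ (contr κ y τ)) (φ' (contr κ y τ)
          (-(WithLp.toLp 2 fun i => κ i * contr κ y τ i)))) τ := by
      intro τ hτ
      exact ((hd _ ((hnR' τ hτ).trans_le hR'R)).comp_hasDerivAt τ
        (contr_hasDerivAt κ y τ)).norm_sq
    have hanti : AntitoneOn (fun τ => ‖φ (contr κ y τ)‖ ^ 2) (Set.Ici 0) := by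
      apply antitoneOn_of_deriv_nonpos (convex_Ici 0)
      · intro τ hτ
        exact (hder τ hτ).continuousAt.continuousWithinAt
      · intro τ hτ
        rw [interior_Ici] at hτ
        exact (hder τ (le_of_lt hτ)).differentiableAt.differentiableWithinAt
      · intro τ hτ
        rw [interior_Ici] at hτ
        have hτ' : 0 ≤ τ := le_of_lt hτ
        rw [(hder τ hτ').deriv, map_neg, inner_neg_right]
        set z := contr κ y τ with hz
        have key := hm z (WithLp.toLp 2 fun i => κ i * z i) ((hnR' τ hτ').trans_le hR'R) ?_
        · linarith
        have hb : ∀ i, |((WithLp.toLp 2 fun i => κ i * z i) - z : EuclideanSpace ℝ (Fin n)) i|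
            ≤ ν i0 * (η * ‖z‖) := by
          intro i
          have e : ((WithLp.toLp 2 fun i => κ i * z i) - z : EuclideanSpace ℝ (Fin n)) i
            = (κ i - 1) * z i := by simp; ring
          rw [e]
          by_cases hi : ν i0 ≤ ν i
          · rw [hκeq i hi]; simp; positivity
          · rw [abs_mul, abs_of_nonneg (by linarith [hκ1 i])]
            apply mul_le_mul (by linarith [hκle i]) _ (abs_nonneg _) hν0.le
            exact small_aux t ν hν heven i0 h0 hpos η R' hη hR'1 hR' z (hnR' τ hτ').le
              (hfl y hy τ hτ').2.1 i (by omega)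
        refine (norm_le_aux _ _ (by positivity) hb).trans (le_of_eq ?_)
        rw [hηdef]; field_simp
    refine ⟨hnR' τ hτ, ?_, (hfl y hy τ hτ).2⟩
    have h7 := hanti (Set.mem_Ici.2 le_rfl) (Set.mem_Ici.2 hτ) hτ
    have h8 : contr κ y 0 = y := by ext i; simp [contr]
    simp only [h8] at h7
    exact (le_of_pow_le_pow_left₀ two_ne_zero (norm_nonneg _) h7).trans_lt hy.2.1
  refine ⟨EuclideanSpace.single i0 (σ * (ε / 2)), haxis _ ?_ ?_, ?_⟩
  · rw [← mul_assoc, hσ2]; linarith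
  · rw [abs_mul, hσa, abs_of_pos (by linarith)]; linarith
  intro y hy
  apply JoinedIn.symm
  obtain ⟨N, hN0, hN⟩ : ∃ N : ℝ, 0 ≤ N ∧ Real.exp (-N) * ‖y‖ < ε := by
    have : Filter.Tendsto (fun N : ℝ => Real.exp (-N) * ‖y‖) Filter.atTop (nhds (0 * ‖y‖)) :=
      (Real.tendsto_exp_neg_atTop_nhds_zero).mul_const _
    rw [zero_mul] at this
    obtain ⟨N, h1, h2⟩ := ((Filter.eventually_ge_atTop 0).and
      (this.eventually (eventually_lt_nhds hε))).exists
    exact ⟨N, h1, h2⟩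
  set z := contr κ y N with hz
  have hzS : z ∈ S := hflS y hy N hN0
  have hzε : ‖z‖ < ε := (contr_bound κ hκ1 y N hN0).trans_lt hN
  have j1 : JoinedIn S y z := by
    apply JoinedIn.ofLine (f := fun u : ℝ => contr κ y (N * u))
    · have : Continuous (contr κ y) := continuous_iff_continuousAt.2 fun τ =>
        (contr_hasDerivAt κ y τ).continuousAt
      exact (this.comp (by fun_prop)).continuousOn
    · ext i; simp [contr]
    · simp [hz]
    · rintro _ ⟨u, hu, rfl⟩
      exact hflS y hy _ (mul_nonneg hN0 hu.1)
  refine (j1.trans (hnear z hzS hzε)).trans ?_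
  apply JoinedIn.ofLine (f := fun u : ℝ =>
    (EuclideanSpace.single i0 ((1 - u) * z i0 + u * (σ * (ε / 2))) : EuclideanSpace ℝ (Fin n)))
  · apply Continuous.continuousOn
    have h9 : (fun u : ℝ => (EuclideanSpace.single i0 ((1 - u) * z i0 + u * (σ * (ε / 2))) :
        EuclideanSpace ℝ (Fin n))) = fun u : ℝ => ((1 - u) * z i0 + u * (σ * (ε / 2))) •
        (EuclideanSpace.single i0 1 : EuclideanSpace ℝ (Fin n)) := by
      funext u
      ext j
      by_cases hj : j = i0
      · subst hj; simp
      · simp [hj]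
    rw [h9]
    fun_prop
  · simp
  · simp
  · rintro _ ⟨u, hu, rfl⟩
    have hzi : |z i0| < ε := (PiLp.norm_apply_le z i0).trans_lt hzε
    have hzp := hzS.2.2.2
    have hrep : ∀ b : ℝ, |b| = |σ * b| := by intro b; rw [abs_mul, hσa, one_mul]
    have e : σ * ((1 - u) * z i0 + u * (σ * (ε / 2))) = (1 - u) * (σ * z i0) + u * (ε / 2) := by
      linear_combination u * (ε / 2) * hσ2
    have hu0 := hu.1
    have hu1 := hu.2
    have hzlt : σ * z i0 < ε := by rw [hrep] at hzi; exact (le_abs_self _).trans_lt hzi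
    have hpos' : 0 < (1 - u) * (σ * z i0) + u * (ε / 2) := by
      rcases eq_or_lt_of_le hu0 with h | h
      · rw [← h]; simpa using hzp
      · have := mul_nonneg (sub_nonneg.2 hu1) hzp.le
        positivity
    apply haxis
    · rw [e]; exact hpos'
    · rw [hrep, e, abs_of_pos hpos']
      nlinarith

theorem est_aux {n : ℕ} (s : EuclideanSpace ℝ (Fin n))
    (U : EuclideanSpace ℝ (Fin n) → EuclideanSpace ℝ (Fin n))
    (hU : ContDiffAt ℝ (⊤ : ℕ∞) U s) (hUs : U s = s)
    (dU : EuclideanSpace ℝ (Fin n) ≃L[ℝ] EuclideanSpace ℝ (Fin n))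
    (hdU : HasFDerivAt U (dU : EuclideanSpace ℝ (Fin n) →L[ℝ] EuclideanSpace ℝ (Fin n)) s) :
    ∃ η' > 0, ∃ R > 0,
      (∀ y, ‖y‖ < R → HasFDerivAt (fun y => U (s + y) - s) (fderiv ℝ U (s + y)) y) ∧
      (∀ y w, ‖y‖ < R → ‖w - y‖ ≤ η' * ‖y‖ →
        0 ≤ inner ℝ (U (s + y) - s) (fderiv ℝ U (s + y) w)) := by
  set A := (dU : EuclideanSpace ℝ (Fin n) →L[ℝ] EuclideanSpace ℝ (Fin n)) with hA
  obtain ⟨k, hk, hkA⟩ : ∃ k > 0, ∀ y, k * ‖y‖ ≤ ‖A y‖ := by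
    refine ⟨1 / (‖(dU.symm : EuclideanSpace ℝ (Fin n) →L[ℝ] EuclideanSpace ℝ (Fin n))‖ + 1),
      by positivity, ?_⟩
    intro y
    have h := (dU.symm : EuclideanSpace ℝ (Fin n) →L[ℝ] EuclideanSpace ℝ (Fin n)).le_opNorm (dU y)
    simp only [ContinuousLinearEquiv.coe_coe, ContinuousLinearEquiv.symm_apply_apply] at h
    have : ‖A y‖ = ‖dU y‖ := rfl
    rw [this, one_div, inv_mul_le_iff₀ (by positivity)]
    nlinarith [norm_nonneg (dU y)]
  set ε := k / 8 with hε
  have hε0 : 0 < ε := by positivity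
  set η' := min 1 (ε / (‖A‖ + 1)) with hη'
  have hη0 : 0 < η' := by positivity
  have hdiff : ∀ᶠ x in nhds s, DifferentiableAt ℝ U x := by
    have h1 : ContDiffAt ℝ 1 U s := hU.of_le (by exact_mod_cast le_top)
    filter_upwards [h1.eventually (by simp)] with x hx
    exact hx.differentiableAt (by simp)
  have hcont : ContinuousAt (fderiv ℝ U) s := by
    have h1 : ContDiffAt ℝ 0 (fderiv ℝ U) s := hU.fderiv_right (m := 0) (by
      rw [zero_add]; exact_mod_cast le_top)
    exact h1.continuousAt
  have hclose : ∀ᶠ x in nhds s, ‖fderiv ℝ U x - A‖ < ε := by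
    have := Metric.tendsto_nhds.1 hcont.tendsto ε hε0
    rw [hdU.fderiv] at this
    simpa [dist_eq_norm] using this
  have hlin : ∀ᶠ x in nhds s, ‖U x - U s - A (x - s)‖ ≤ ε * ‖x - s‖ :=
    hdU.isLittleO.def hε0
  obtain ⟨R, hR0, hR⟩ := Metric.eventually_nhds_iff.1 (hdiff.and (hclose.and hlin))
  have hR' : ∀ y, ‖y‖ < R → DifferentiableAt ℝ U (s + y) ∧ ‖fderiv ℝ U (s + y) - A‖ < ε ∧
      ‖U (s + y) - s - A y‖ ≤ ε * ‖y‖ := by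
    intro y hy
    have := @hR (s + y) (by simpa [dist_eq_norm] using hy)
    simpa [hUs] using this
  refine ⟨η', hη0, R, hR0, ?_, ?_⟩
  · intro y hy
    have h1 := (hR' y hy).1.hasFDerivAt
    have h2 : HasFDerivAt (fun y => s + y)
        (ContinuousLinearMap.id ℝ (EuclideanSpace ℝ (Fin n))) y := (hasFDerivAt_id y).const_add s
    exact (h1.comp y h2).sub_const s
  · intro y w hy hw
    obtain ⟨-, h2, h3⟩ := hR' y hy
    set D := fderiv ℝ U (s + y)
    have hη1 : η' ≤ 1 := min_le_left _ _
    have hη2 : ‖A‖ * η' ≤ ε := by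
      have : η' ≤ ε / (‖A‖ + 1) := min_le_right _ _
      rw [le_div_iff₀ (by positivity)] at this
      nlinarith
    have hY := norm_nonneg y
    have hwn : ‖w‖ ≤ 2 * ‖y‖ := by
      have : ‖w‖ ≤ ‖w - y‖ + ‖y‖ := by simpa using norm_add_le (w - y) y
      nlinarith
    have h4 : ‖D w - A y‖ ≤ 3 * ε * ‖y‖ := by
      have e : D w - A y = (D - A) w + A (w - y) := by simp
      rw [e]
      have a1 := (D - A).le_opNorm w
      have a2 := A.le_opNorm (w - y)
      have a3 : ‖D - A‖ * ‖w‖ ≤ ε * (2 * ‖y‖) := mul_le_mul h2.le hwn (norm_nonneg _) hε0.le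
      have a4 : ‖A‖ * ‖w - y‖ ≤ ‖A‖ * (η' * ‖y‖) := mul_le_mul_of_nonneg_left hw (norm_nonneg _)
      have a5 := mul_le_mul_of_nonneg_right hη2 hY
      have := norm_add_le ((D - A) w) (A (w - y))
      nlinarith
    set a := A y
    obtain ⟨p, hp⟩ : ∃ p, p = U (s + y) - s - a := ⟨_, rfl⟩
    obtain ⟨q, hq⟩ : ∃ q, q = D w - a := ⟨_, rfl⟩
    have e1 : U (s + y) - s = a + p := by rw [hp]; abel
    have e2 : D w = a + q := by rw [hq]; abel
    rw [← hp] at h3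
    rw [← hq] at h4
    rw [e1, e2]
    have hka := hkA y
    have hp' : ‖p‖ ≤ ‖a‖ / 8 := by
      have : ε * ‖y‖ = k * ‖y‖ / 8 := by rw [hε]; ring
      linarith
    have hq' : ‖q‖ ≤ 3 * ‖a‖ / 8 := by
      have : 3 * ε * ‖y‖ = 3 * (k * ‖y‖) / 8 := by rw [hε]; ring
      linarith
    rw [inner_add_left, inner_add_right, inner_add_right, real_inner_self_eq_norm_sq]
    have b1 := neg_le_of_abs_le (abs_real_inner_le_norm a q)
    have b2 := neg_le_of_abs_le (abs_real_inner_le_norm p a)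
    have b3 := neg_le_of_abs_le (abs_real_inner_le_norm p q)
    have ha := norm_nonneg a
    have c1 : ‖a‖ * ‖q‖ ≤ ‖a‖ * (3 * ‖a‖ / 8) := mul_le_mul_of_nonneg_left hq' ha
    have c2 : ‖p‖ * ‖a‖ ≤ ‖a‖ / 8 * ‖a‖ := mul_le_mul_of_nonneg_right hp' ha
    have c3 : ‖p‖ * ‖q‖ ≤ ‖a‖ / 8 * (3 * ‖a‖ / 8) :=
      mul_le_mul hp' hq' (norm_nonneg _) (by positivity)
    nlinarith [sq_nonneg ‖a‖]


set_option maxHeartbeats 1000000 in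
/-- Let `W : ℝ^n → ℝ` be `C^∞` admitting the degenerate normal form at `s`:
there is a `C^∞` diffeomorphism `U` from a neighborhood `𝒱` of `s` onto an open neighborhood of
`s`, with `U s = s` and `d_s U` invertible, nonzero reals `t_i` and integers `ν_i ≥ 2` such that
`W (U x) − W s = Σ_i t_i (x_i − s_i)^{ν_i}` on `𝒱`. If every `ν_i` is even and exactly one `t_i`
is negative, then for every small `r > 0` the set `B(s,r) ∩ {W < W s}` has exactly two connected
components. -/
theorem stmt5 (n : ℕ) (hn : 1 ≤ n) (W : EuclideanSpace ℝ (Fin n) → ℝ)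
    (hW : ContDiff ℝ (⊤ : ℕ∞) W) (s : EuclideanSpace ℝ (Fin n))
    (𝒱 : Set (EuclideanSpace ℝ (Fin n))) (h𝒱 : IsOpen 𝒱) (hs : s ∈ 𝒱)
    (U Uinv : EuclideanSpace ℝ (Fin n) → EuclideanSpace ℝ (Fin n))
    (hU : ContDiffOn ℝ (⊤ : ℕ∞) U 𝒱) (hUs : U s = s)
    (hUinj : Set.InjOn U 𝒱) (hUopen : IsOpen (U '' 𝒱))
    (hUinv : ContDiffOn ℝ (⊤ : ℕ∞) Uinv (U '' 𝒱))
    (hUinv' : ∀ x ∈ 𝒱, Uinv (U x) = x)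
    (dU : EuclideanSpace ℝ (Fin n) ≃L[ℝ] EuclideanSpace ℝ (Fin n))
    (hdU : HasFDerivAt U (dU : EuclideanSpace ℝ (Fin n) →L[ℝ] EuclideanSpace ℝ (Fin n)) s)
    (t : Fin n → ℝ) (ht : ∀ i, t i ≠ 0)
    (ν : Fin n → ℕ) (hν : ∀ i, 2 ≤ ν i)
    (hnf : ∀ x ∈ 𝒱, W (U x) - W s = ∑ i, t i * (x i - s i) ^ (ν i))
    (heven : ∀ i, Even (ν i)) (hneg : ∃! i, t i < 0) :
    ∃ r₀ > 0, ∀ r : ℝ, 0 < r → r < r₀ →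
      Nat.card (ConnectedComponents
        ↥(Metric.ball s r ∩ {x : EuclideanSpace ℝ (Fin n) | W x < W s})) = 2 := by
  obtain ⟨i0, h0, huniq⟩ := hneg
  have hpos : ∀ i, i ≠ i0 → 0 < t i := by
    intro i hi
    rcases lt_or_gt_of_ne (ht i) with h | h
    · exact absurd (huniq i h) hi
    · exact h
  obtain ⟨η', hη', R1, hR1, hd, hm⟩ := est_aux s U (hU.contDiffAt (h𝒱.mem_nhds hs)) hUs dU hdU
  obtain ⟨R2, hR2, hRV⟩ := Metric.isOpen_iff.1 h𝒱 s hs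
  obtain ⟨R, hR, hRle, hcore⟩ := core_aux t ν hν heven i0 h0 hpos (fun y => U (s + y) - s)
    (fun y => fderiv ℝ U (s + y)) (by simp [hUs]) η' (min R1 R2) hη' (lt_min hR1 hR2)
    (fun y hy => hd y (hy.trans_le (min_le_left _ _)))
    (fun y w hy hw => hm y w (hy.trans_le (min_le_left _ _)) hw)
  have hV : ∀ y, ‖y‖ < R → s + y ∈ 𝒱 := by
    intro y hy
    apply hRV
    simpa using hy.trans_le (hRle.trans (min_le_right _ _))
  have hUinvs : Uinv s = s := by simpa [hUs] using hUinv' s hs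
  have hsU : s ∈ U '' 𝒱 := ⟨s, hs, hUs⟩
  have hUic : ContinuousOn Uinv (U '' 𝒱) := hUinv.continuousOn
  have hcs : ContinuousAt Uinv s := hUic.continuousAt (hUopen.mem_nhds hsU)
  have hev : ∀ᶠ x in nhds s, x ∈ U '' 𝒱 ∧ dist (Uinv x) s < R := by
    refine Filter.Eventually.and (hUopen.mem_nhds hsU) ?_
    have := Metric.tendsto_nhds.1 hcs.tendsto R hR
    rwa [hUinvs] at this
  obtain ⟨r₀, hr₀, hball⟩ := Metric.eventually_nhds_iff.1 hev
  refine ⟨r₀, hr₀, ?_⟩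
  intro r hr hrr
  set S := Metric.ball s r ∩ {x : EuclideanSpace ℝ (Fin n) | W x < W s} with hS
  have hSU : ∀ x ∈ S, x ∈ U '' 𝒱 ∧ dist (Uinv x) s < R := fun x hx =>
    hball (lt_trans hx.1 hrr)
  let C : ℝ → Set (EuclideanSpace ℝ (Fin n)) := fun σ => {y |
    ‖y‖ < R ∧ ‖U (s + y) - s‖ < r ∧ ∑ i, t i * y i ^ ν i < 0 ∧ 0 < σ * y i0}
  have hC : ∀ σ : ℝ, (σ = 1 ∨ σ = -1) → IsPathConnected (C σ) := fun σ hσ => hcore r hr σ hσ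
  have hWy : ∀ y, ‖y‖ < R → W (U (s + y)) - W s = ∑ i, t i * y i ^ ν i := by
    intro y hy
    simpa using hnf (s + y) (hV y hy)
  let P : ℝ → Set S := fun σ => {x | 0 < σ * (Uinv x.1 i0 - s i0)}
  have hPim : ∀ σ, Subtype.val '' (P σ) = (fun y => U (s + y)) '' C σ := by
    intro σ
    ext x
    constructor
    · rintro ⟨⟨x, hx⟩, hxP, rfl⟩
      obtain ⟨⟨v, hv, rfl⟩, hx2⟩ := hSU x hx
      have hxP' : 0 < σ * (Uinv (U v) i0 - s i0) := hxP
      rw [hUinv' v hv] at hx2 hxP'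
      have hsv : s + (v - s) = v := by abel
      have hvn : ‖v - s‖ < R := by rwa [dist_eq_norm] at hx2
      refine ⟨v - s, ⟨hvn, ?_, ?_, ?_⟩, ?_⟩
      · rw [hsv, ← dist_eq_norm]; exact hx.1
      · rw [← hWy _ hvn, hsv]
        exact sub_neg.2 hx.2
      · simpa using hxP'
      · simp only [hsv]
    · rintro ⟨y, ⟨hy1, hy2, hy3, hy4⟩, rfl⟩
      have hxS : U (s + y) ∈ S := by
        refine ⟨by rwa [Metric.mem_ball, dist_eq_norm], ?_⟩
        rw [← hWy y hy1] at hy3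
        exact sub_neg.1 hy3
      refine ⟨⟨U (s + y), hxS⟩, ?_, rfl⟩
      change 0 < σ * (Uinv (U (s + y)) i0 - s i0)
      rw [hUinv' _ (hV y hy1)]
      simpa using hy4
  have hcontU : ∀ σ, ContinuousOn (fun y => U (s + y)) (C σ) := by
    intro σ
    apply hU.continuousOn.comp (by fun_prop)
    intro y hy
    exact hV y hy.1
  have hPconn : ∀ σ : ℝ, (σ = 1 ∨ σ = -1) → IsConnected (P σ) := by
    intro σ hσ
    have h1 : IsConnected (Subtype.val '' (P σ)) := by
      rw [hPim]
      exact (hC σ hσ).isConnected.image _ (hcontU σ)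
    exact ⟨h1.1.of_image, Topology.IsInducing.subtypeVal.isPreconnected_image.1 h1.2⟩
  have hPopen : ∀ σ, IsOpen (P σ) := by
    intro σ
    have hc : Continuous (fun x : S => Uinv x.1) :=
      hUic.comp_continuous continuous_subtype_val fun x => (hSU x.1 x.2).1
    have hc2 : Continuous (fun x : S => σ * (Uinv x.1 i0 - s i0)) :=
      continuous_const.mul (((EuclideanSpace.proj (𝕜 := ℝ) i0).continuous.comp hc).sub continuous_const)
    exact isOpen_lt continuous_const hc2
  have hcompl : (P 1)ᶜ = P (-1) := by
    ext ⟨x, hx⟩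
    obtain ⟨⟨v, hv, rfl⟩, hx2⟩ := hSU x hx
    change ¬ (0 < 1 * (Uinv (U v) i0 - s i0)) ↔ 0 < -1 * (Uinv (U v) i0 - s i0)
    rw [hUinv' v hv]
    have hne : v i0 - s i0 ≠ 0 := by
      intro hz
      have h1 : W (U v) - W s < 0 := sub_neg.2 hx.2
      rw [hnf v hv] at h1
      refine absurd h1 (not_lt.2 (Finset.sum_nonneg ?_))
      intro i _
      by_cases hi : i = i0
      · have := hν i0
        rw [hi, hz, zero_pow (by omega), mul_zero]
      · exact mul_nonneg (hpos i hi).le ((heven i).pow_nonneg _)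
    constructor
    · intro h
      have : v i0 - s i0 < 0 := lt_of_le_of_ne (by linarith) hne
      linarith
    · intro h h'
      linarith
  have k1 := hPconn 1 (Or.inl rfl)
  have k2 := hPconn (-1) (Or.inr rfl)
  refine card_two_aux (P 1) ⟨?_, hPopen 1⟩ k1.2 (by rw [hcompl]; exact k2.2) k1.1
    (by rw [hcompl]; exact k2.1)
  rw [← isOpen_compl_iff, hcompl]
  exact hPopen (-1)
end

section
/- Let n ≥ 1 and let W : ℝ^n → ℝ be a C^∞ function. Let s ∈ ℝ^n and assume W admits the degenerate normal form at s: there exist an open neighborhood 𝒱 of s, a C^∞ diffeomorphism U from 𝒱 onto an open neighborhood of s with U(s) = s and d_sU invertible, nonzero reals t₁,…,t_n, and integers ν₁,…,ν_n ≥ 2 such that W(U(x)) − W(s) = Σ_{i=1}^n t_i (x_i − s_i)^{ν_i} for all x ∈ 𝒱. Assume moreover that either (a) at least one ν_i is odd, or (b) all ν_i are even and at least two of the t_i are negative. Then there exists r₀ > 0 such that for every 0 < r < r₀, the set B(s,r) ∩ {x ∈ ℝ^n : W(x) < W(s)} is nonempty and connected (it has exactly one connected component). -/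
open Set Filter Topology

noncomputable def FF {n : ℕ} (t : Fin n → ℝ) (ν : Fin n → ℕ) (y : Fin n → ℝ) : ℝ :=
  ∑ i, t i * (y i) ^ (ν i)

def boxNeg {n : ℕ} (t : Fin n → ℝ) (ν : Fin n → ℕ) (a : ℝ) : Set (Fin n → ℝ) :=
  {y | (∀ i, |y i| ≤ a) ∧ FF t ν y < 0}

lemma FF_neg_of {n : ℕ} {t : Fin n → ℝ} {ν : Fin n → ℕ} {y : Fin n → ℝ}
    (h : ∀ i, t i * y i ^ ν i ≤ 0) (k : Fin n) (hk : t k * y k ^ ν k < 0) : FF t ν y < 0 :=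
  Finset.sum_neg' (fun i _ => h i) ⟨k, Finset.mem_univ k, hk⟩

lemma abs_comb {a τ u v : ℝ} (h0 : 0 ≤ τ) (h1 : τ ≤ 1) (hu : |u| ≤ a) (hv : |v| ≤ a) :
    |(1 - τ) * u + τ * v| ≤ a := by
  rw [abs_le] at *
  constructor <;> nlinarith [mul_nonneg h0 (sub_nonneg.2 hv.2), mul_nonneg h0 (sub_nonneg.2 hv.1),
    mul_nonneg (sub_nonneg.2 h1) (sub_nonneg.2 hu.2), mul_nonneg (sub_nonneg.2 h1) (sub_nonneg.2 hu.1)]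

/-- Straight segments in the box along which `FF` is negative. -/
lemma joined_seg {n : ℕ} {t : Fin n → ℝ} {ν : Fin n → ℕ} {a : ℝ} {y z : Fin n → ℝ}
    (hy : ∀ i, |y i| ≤ a) (hz : ∀ i, |z i| ≤ a)
    (h : ∀ τ : ℝ, 0 ≤ τ → τ ≤ 1 → FF t ν (fun i => (1 - τ) * y i + τ * z i) < 0) :
    JoinedIn (boxNeg t ν a) y z := by
  refine JoinedIn.ofLine (f := fun τ : ℝ => fun i => (1 - τ) * y i + τ * z i) ?_ ?_ ?_ ?_
  · fun_prop
  · simp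
  · simp
  · rintro _ ⟨τ, ⟨h0, h1⟩, rfl⟩
    exact ⟨fun i => abs_comb h0 h1 (hy i) (hz i), h τ h0 h1⟩

lemma abs_single {n : ℕ} {a u : ℝ} (i : Fin n) (hu : |u| ≤ a) (j : Fin n) :
    |(Pi.single i u : Fin n → ℝ) j| ≤ a := by
  by_cases h : j = i
  · subst h; simpa
  · simp [Pi.single_eq_of_ne h]; exact (abs_nonneg u).trans hu

/-- Every point is joined to an axis point. -/
lemma joined_axis {n : ℕ} {t : Fin n → ℝ} {ν : Fin n → ℕ} (hν : ∀ i, 2 ≤ ν i) {a : ℝ}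
    {y : Fin n → ℝ} (hy : y ∈ boxNeg t ν a) :
    ∃ i u, |u| ≤ a ∧ t i * u ^ ν i < 0 ∧ JoinedIn (boxNeg t ν a) y (Pi.single i u) := by
  obtain ⟨hya, hyF⟩ := hy
  have ha : ∀ i : Fin n, 0 ≤ a := fun i => (abs_nonneg _).trans (hya i)
  obtain ⟨k, -, hk⟩ : ∃ k ∈ Finset.univ, t k * y k ^ ν k < 0 := by
    by_contra! hcon
    exact absurd hyF (not_lt.2 (Finset.sum_nonneg hcon))
  refine ⟨k, y k, hya k, hk, ?_⟩
  set z : Fin n → ℝ := fun i => if 0 < t i * y i ^ ν i then 0 else y i with hz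
  have hza : ∀ i, |z i| ≤ a := by
    intro i; simp only [hz]; split_ifs
    · simpa using ha i
    · exact hya i
  have hz0 : ∀ i, t i * z i ^ ν i ≤ 0 := by
    intro i
    have := hν i
    by_cases h : 0 < t i * y i ^ ν i
    · simp only [hz, if_pos h]; rw [zero_pow (by omega)]; simp
    · simp only [hz, if_neg h]; exact not_lt.1 h
  have hzk : z k = y k := by simp only [hz, if_neg (not_lt.2 hk.le)]
  have j1 : JoinedIn (boxNeg t ν a) y z := by
    refine joined_seg hya hza fun τ h0 h1 => lt_of_le_of_lt (Finset.sum_le_sum fun i _ => ?_) hyF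
    by_cases h : 0 < t i * y i ^ ν i
    · simp only [hz, if_pos h]
      have : t i * ((1 - τ) * y i + τ * 0) ^ ν i = (1 - τ) ^ ν i * (t i * y i ^ ν i) := by
        rw [mul_zero, add_zero, mul_pow]; ring
      rw [this]
      exact mul_le_of_le_one_left h.le (pow_le_one₀ (by linarith) (by linarith))
    · simp only [hz, if_neg h]
      apply le_of_eq; congr 2; ring
  have j2 : JoinedIn (boxNeg t ν a) z (Pi.single k (y k)) := by
    refine joined_seg hza (abs_single k (hya k)) fun τ h0 h1 => FF_neg_of (fun i => ?_) k ?_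
    · by_cases h : i = k
      · subst h
        simp only [Pi.single_eq_same, hzk]
        have : (1 - τ) * y i + τ * y i = y i := by ring
        rw [this]; exact hk.le
      · simp only [Pi.single_eq_of_ne h]
        have : t i * ((1 - τ) * z i + τ * 0) ^ ν i = (1 - τ) ^ ν i * (t i * z i ^ ν i) := by
          rw [mul_zero, add_zero, mul_pow]; ring
        rw [this]
        exact mul_nonpos_of_nonneg_of_nonpos (pow_nonneg (by linarith) _) (hz0 i)
    · simp only [Pi.single_eq_same, hzk]
      have : (1 - τ) * y k + τ * y k = y k := by ring
      rw [this]; exact hk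
  exact j1.trans j2

lemma joined_diff {n : ℕ} {t : Fin n → ℝ} {ν : Fin n → ℕ} (hν : ∀ i, 2 ≤ ν i) {a : ℝ}
    {i j : Fin n} {u v : ℝ} (hij : i ≠ j) (hu : |u| ≤ a) (hv : |v| ≤ a)
    (hun : t i * u ^ ν i < 0) (hvn : t j * v ^ ν j < 0) :
    JoinedIn (boxNeg t ν a) (Pi.single i u) (Pi.single j v) := by
  refine joined_seg (abs_single i hu) (abs_single j hv) fun τ h0 h1 => ?_
  have key : ∀ l, t l * ((1 - τ) * (Pi.single i u : Fin n → ℝ) l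
      + τ * (Pi.single j v : Fin n → ℝ) l) ^ ν l =
      if l = i then (1 - τ) ^ ν i * (t i * u ^ ν i) else
      if l = j then τ ^ ν j * (t j * v ^ ν j) else 0 := by
    intro l
    by_cases h : l = i
    · subst h; simp [Pi.single_eq_of_ne hij, mul_pow]; ring
    · by_cases h' : l = j
      · subst h'; simp [h, Pi.single_eq_of_ne h, mul_pow]; ring
      · have := hν l
        simp [h, h', Pi.single_eq_of_ne h, Pi.single_eq_of_ne h']; right; omega
  have hle : ∀ l, t l * ((1 - τ) * (Pi.single i u : Fin n → ℝ) l
      + τ * (Pi.single j v : Fin n → ℝ) l) ^ ν l ≤ 0 := by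
    intro l; rw [key]; split_ifs
    · exact mul_nonpos_of_nonneg_of_nonpos (pow_nonneg (by linarith) _) hun.le
    · exact mul_nonpos_of_nonneg_of_nonpos (pow_nonneg h0 _) hvn.le
    · exact le_rfl
  rcases h0.eq_or_lt with h | h
  · refine FF_neg_of hle i ?_
    rw [key, if_pos rfl, ← h]; simpa using hun
  · refine FF_neg_of hle j ?_
    rw [key, if_neg hij.symm, if_pos rfl]
    exact mul_neg_of_pos_of_neg (pow_pos h _) hvn

lemma joined_odd {n : ℕ} {t : Fin n → ℝ} {ν : Fin n → ℕ} (hν : ∀ i, 2 ≤ ν i) {a : ℝ}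
    {i : Fin n} {u v : ℝ} (hi : Odd (ν i)) (hu : |u| ≤ a) (hv : |v| ≤ a)
    (hun : t i * u ^ ν i < 0) (hvn : t i * v ^ ν i < 0) :
    JoinedIn (boxNeg t ν a) (Pi.single i u) (Pi.single i v) := by
  refine joined_seg (abs_single i hu) (abs_single i hv) fun τ h0 h1 => ?_
  have hw : t i * ((1 - τ) * u + τ * v) ^ ν i < 0 := by
    rcases lt_trichotomy (t i) 0 with h | h | h
    · have h2 : 0 < u := hi.pow_pos_iff.1 (by by_contra! hc; nlinarith)
      have h3 : 0 < v := hi.pow_pos_iff.1 (by by_contra! hc; nlinarith)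
      refine mul_neg_of_neg_of_pos h (hi.pow_pos_iff.2 ?_)
      rcases h0.eq_or_lt with h | h
      · subst h; simpa
      · nlinarith [mul_pos h h3, mul_nonneg (sub_nonneg.2 h1) h2.le]
    · simp [h] at hun
    · have h2 : u < 0 := hi.pow_neg_iff.1 (by by_contra! hc; nlinarith)
      have h3 : v < 0 := hi.pow_neg_iff.1 (by by_contra! hc; nlinarith)
      refine mul_neg_of_pos_of_neg h (hi.pow_neg_iff.2 ?_)
      rcases h0.eq_or_lt with h | h
      · subst h; simpa
      · nlinarith [mul_neg_of_pos_of_neg h h3, mul_nonneg (sub_nonneg.2 h1) (neg_nonneg.2 h2.le)]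
  refine FF_neg_of (fun l => ?_) i (by simpa using hw)
  by_cases h : l = i
  · subst h; simpa using hw.le
  · have := hν l
    simp only [Pi.single_eq_of_ne h, mul_zero, add_zero]
    rw [zero_pow (by omega)]; simp

lemma odd_dir {t a : ℝ} {k : ℕ} (hk : Odd k) (ht : t ≠ 0) (ha : 0 < a) :
    ∃ u, |u| ≤ a ∧ t * u ^ k < 0 := by
  rcases lt_or_gt_of_ne ht with h | h
  · exact ⟨a, by rw [abs_of_pos ha], mul_neg_of_neg_of_pos h (pow_pos ha _)⟩
  · exact ⟨-a, by rw [abs_neg, abs_of_pos ha], mul_neg_of_pos_of_neg h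
      (hk.pow_neg_iff.2 (by linarith))⟩

lemma axis_joined {n : ℕ} {t : Fin n → ℝ} {ν : Fin n → ℕ} (ht : ∀ i, t i ≠ 0)
    (hν : ∀ i, 2 ≤ ν i)
    (hcase : (∃ i, Odd (ν i)) ∨
      ((∀ i, Even (ν i)) ∧ ∃ i j : Fin n, i ≠ j ∧ t i < 0 ∧ t j < 0)) {a : ℝ} (ha : 0 < a)
    {i j : Fin n} {u v : ℝ} (hu : |u| ≤ a) (hv : |v| ≤ a)
    (hun : t i * u ^ ν i < 0) (hvn : t j * v ^ ν j < 0) :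
    JoinedIn (boxNeg t ν a) (Pi.single i u) (Pi.single j v) := by
  by_cases hij : i = j
  swap
  · exact joined_diff hν hij hu hv hun hvn
  subst hij
  by_cases hi : Odd (ν i)
  · exact joined_odd hν hi hu hv hun hvn
  have hex : ∃ l w, l ≠ i ∧ |w| ≤ a ∧ t l * w ^ ν l < 0 := by
    rcases hcase with ⟨l, hl⟩ | ⟨-, p, q, hpq, hp, hq⟩
    · obtain ⟨w, hw⟩ := odd_dir hl (ht l) ha
      exact ⟨l, w, by rintro rfl; exact hi hl, hw⟩
    · by_cases h : p = i
      · exact ⟨q, a, by rintro rfl; exact hpq h, by rw [abs_of_pos ha],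
          mul_neg_of_neg_of_pos hq (pow_pos ha _)⟩
      · exact ⟨p, a, h, by rw [abs_of_pos ha], mul_neg_of_neg_of_pos hp (pow_pos ha _)⟩
  obtain ⟨l, w, hl, hw, hwn⟩ := hex
  exact (joined_diff hν hl.symm hu hw hun hwn).trans (joined_diff hν hl hw hv hwn hvn)

lemma boxNeg_pathConnected {n : ℕ} {t : Fin n → ℝ} {ν : Fin n → ℕ} (ht : ∀ i, t i ≠ 0)
    (hν : ∀ i, 2 ≤ ν i)
    (hcase : (∃ i, Odd (ν i)) ∨
      ((∀ i, Even (ν i)) ∧ ∃ i j : Fin n, i ≠ j ∧ t i < 0 ∧ t j < 0)) {a : ℝ} (ha : 0 < a) :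
    IsPathConnected (boxNeg t ν a) := by
  have hex : ∃ l w, |w| ≤ a ∧ t l * w ^ ν l < 0 := by
    rcases hcase with ⟨l, hl⟩ | ⟨-, p, q, hpq, hp, hq⟩
    · obtain ⟨w, hw⟩ := odd_dir hl (ht l) ha
      exact ⟨l, w, hw⟩
    · exact ⟨p, a, by rw [abs_of_pos ha], mul_neg_of_neg_of_pos hp (pow_pos ha _)⟩
  obtain ⟨l, w, hw, hwn⟩ := hex
  refine ⟨Pi.single l w, ?_, fun {y} hy => ?_⟩
  · exact (axis_joined ht hν hcase ha hw hw hwn hwn).source_mem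
  · obtain ⟨i, u, hu, hun, hj⟩ := joined_axis hν hy
    exact (axis_joined ht hν hcase ha hw hu hwn hun).trans hj.symm

lemma small_pow {p q : ℕ} (hpq : p < q) {B D : ℝ} (hB : 0 < B) (hD : 0 < D) :
    ∀ᶠ r in 𝓝[>] (0 : ℝ), B * r ^ q ≤ D * r ^ p := by
  have h1 : ∀ᶠ r in 𝓝[>] (0 : ℝ), r ∈ Ioo 0 (min 1 (D / B)) :=
    Ioo_mem_nhdsGT (lt_min one_pos (div_pos hD hB))
  filter_upwards [h1] with r hr
  have hr0 := hr.1
  have hr1 : r < 1 := hr.2.trans_le (min_le_left _ _)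
  have hr2 : r < D / B := hr.2.trans_le (min_le_right _ _)
  rw [lt_div_iff₀ hB] at hr2
  have h3 : r ^ q ≤ r ^ (p + 1) := pow_le_pow_of_le_one hr0.le hr1.le hpq
  calc B * r ^ q ≤ B * r ^ (p + 1) := by gcongr
    _ = (r * B) * r ^ p := by ring
    _ ≤ D * r ^ p := by gcongr

lemma bern {b : ℝ} (hb0 : 0 ≤ b) (k : ℕ) : 1 - k * (1 - b) ≤ b ^ k := by
  have := one_add_mul_le_pow (a := b - 1) (by linarith) k
  have h2 : 1 + (b - 1) = b := by ring
  rw [h2] at this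
  linarith

lemma pow_gap {a b ε : ℝ} {k M : ℕ} (hk : 1 ≤ k) (hkM : k ≤ M) (hε0 : 0 < ε) (hε : ε ≤ 1)
    (hεa : ε ≤ a) (hb : 0 ≤ b) (hab : b ≤ a) :
    (a - b) * ε ^ M ≤ a ^ k - b ^ k := by
  obtain ⟨k, rfl⟩ : ∃ l, k = l + 1 := ⟨k - 1, by omega⟩
  have h1 : b ^ k ≤ a ^ k := by gcongr
  have h2 : ε ^ M ≤ a ^ k := (pow_le_pow_of_le_one hε0.le hε (by omega)).trans
    (pow_le_pow_left₀ hε0.le hεa k)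
  calc (a - b) * ε ^ M ≤ (a - b) * a ^ k := mul_le_mul_of_nonneg_left h2 (by linarith)
    _ = a ^ (k + 1) - b * a ^ k := by ring
    _ ≤ a ^ (k + 1) - b * b ^ k := by gcongr
    _ = _ := by ring

/-- The estimate behind the contraction. `T` are the terms, `k` the dominating negative one. -/
lemma sum_est {n : ℕ} {ν : Fin n → ℕ} {T : Fin n → ℝ} {M : ℕ} {ε η : ℝ} {k : Fin n}
    (hν : ∀ i, 2 ≤ ν i) (hM : ∀ i, ν i ≤ M) (hε0 : 0 < ε) (hε : ε ≤ 1) (hη0 : 0 < η)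
    (hηn : n * M * η = ε ^ (M + 1)) (hTk : T k < 0)
    (hk : ∀ j, ν k < ν j → -T j ≤ η * (-T k)) (hsum : ∑ j, T j < 0)
    {τ : ℝ} (h0 : 0 ≤ τ) (h1 : τ ≤ 1 - ε) :
    ∑ j, (if j = k then 1 - (1 - ε) * τ else
      if 0 < T j ∧ ν j < ν k then (1 - τ) ^ M else 1 - τ) ^ ν j * T j < 0 := by
  have hb0 : 0 < 1 - τ := by linarith
  have hb1 : 1 - τ ≤ 1 := by linarith
  have hpos : 0 ≤ M * η * τ * (-T k) := by
    have : 0 < -T k := by linarith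
    positivity
  have key : ∀ j, (if j = k then 1 - (1 - ε) * τ else
      if 0 < T j ∧ ν j < ν k then (1 - τ) ^ M else 1 - τ) ^ ν j * T j ≤
      (1 - τ) ^ ν k * T j + (M * η * τ * (-T k) -
        if j = k then n * (M * η * τ * (-T k)) else 0) := by
    intro j
    by_cases hj : j = k
    · subst hj
      simp only [if_true]
      have := pow_gap (a := 1 - (1 - ε) * τ) (b := 1 - τ) (ε := ε) (k := ν j) (M := M)
        (by have := hν j; omega) (hM j) hε0 hε (by nlinarith) hb0.le (by nlinarith)
      have h3 : (n : ℝ) * (M * η * τ * (-T j)) = ε ^ (M + 1) * τ * (-T j) := by rw [← hηn]; ring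
      rw [h3]
      have h4 : (1 - (1 - ε) * τ - (1 - τ)) * ε ^ M = ε ^ (M + 1) * τ := by ring
      rw [h4] at this
      nlinarith
    · simp only [if_neg hj, sub_zero]
      by_cases hT : 0 < T j
      · by_cases hjk : ν j < ν k
        · rw [if_pos ⟨hT, hjk⟩, ← pow_mul]
          have : (1 - τ) ^ (M * ν j) ≤ (1 - τ) ^ ν k :=
            pow_le_pow_of_le_one hb0.le hb1 (by nlinarith [hM k, hν j])
          nlinarith
        · rw [if_neg (fun h => hjk h.2)]
          have : (1 - τ) ^ (ν j) ≤ (1 - τ) ^ ν k :=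
            pow_le_pow_of_le_one hb0.le hb1 (by omega)
          nlinarith
      · rw [if_neg (fun h => hT h.1)]
        push Not at hT
        by_cases hjk : ν k < ν j
        · have h3 := bern hb0.le (ν j)
          have h4 : (1 - τ) ^ ν k ≤ 1 := pow_le_one₀ hb0.le hb1
          have h5 := hk j hjk
          have h6 : (ν j : ℝ) ≤ M := by exact_mod_cast hM j
          have h7 : (1 - τ) ^ ν k - (1 - τ) ^ ν j ≤ M * τ := by nlinarith
          have h8 : ((1 - τ) ^ ν k - (1 - τ) ^ ν j) * (-T j) ≤ (M * τ) * (-T j) :=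
            mul_le_mul_of_nonneg_right h7 (by linarith)
          have h9 : (M * τ) * (-T j) ≤ (M * τ) * (η * (-T k)) :=
            mul_le_mul_of_nonneg_left h5 (by positivity)
          nlinarith
        · have : (1 - τ) ^ (ν k) ≤ (1 - τ) ^ ν j :=
            pow_le_pow_of_le_one hb0.le hb1 (by omega)
          nlinarith
  refine lt_of_le_of_lt (Finset.sum_le_sum fun j _ => key j) ?_
  rw [Finset.sum_add_distrib, ← Finset.mul_sum, Finset.sum_sub_distrib]
  simp only [Finset.sum_const, Finset.card_univ, Fintype.card_fin, nsmul_eq_mul,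
    Finset.sum_ite_eq', Finset.mem_univ, if_true, sub_self, add_zero]
  exact mul_neg_of_pos_of_neg (pow_pos hb0 _) hsum

/-- Contraction of a small point into a smaller box, keeping `FF < 0`. -/
lemma contraction {n : ℕ} (hn : 1 ≤ n) {t : Fin n → ℝ} {ν : Fin n → ℕ} (ht : ∀ i, t i ≠ 0)
    (hν : ∀ i, 2 ≤ ν i) {c C : ℝ} (hc : 0 < c) (hC : 0 < C) :
    ∀ᶠ r in 𝓝[>] (0 : ℝ), ∀ y : Fin n → ℝ, (∀ i, |y i| ≤ C * r) → FF t ν y < 0 →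
      ∃ γ : ℝ → Fin n → ℝ, Continuous γ ∧ γ 0 = y ∧ (∀ i, |γ 1 i| ≤ c * r) ∧
        ∀ x : ℝ, 0 ≤ x → x ≤ 1 → FF t ν (γ x) < 0 ∧
          ∃ τ : ℝ, ∃ z : Fin n → ℝ, 0 ≤ τ ∧ τ ≤ 1 ∧ (∀ i, |z i| ≤ c * r) ∧
            ∀ i, γ x i = (1 - τ) * y i + τ * z i := by
  obtain ⟨ε, hε0, hε2, hεC⟩ : ∃ ε : ℝ, 0 < ε ∧ ε ≤ 1 / 2 ∧ 2 * ε * C ≤ c := by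
    refine ⟨min (1 / 2) (c / (2 * C)), lt_min (by norm_num) (by positivity), min_le_left _ _, ?_⟩
    have := min_le_right (1 / 2) (c / (2 * C))
    rw [le_div_iff₀ (by positivity)] at this
    linarith
  have hε1 : ε ≤ 1 := by linarith
  obtain ⟨M, hM⟩ : ∃ M : ℕ, ∀ i, ν i ≤ M :=
    ⟨∑ i, ν i, fun i => Finset.single_le_sum (f := ν) (fun _ _ => Nat.zero_le _) (Finset.mem_univ i)⟩
  have hM1 : 1 ≤ M := le_trans (by have := hν ⟨0, hn⟩; omega) (hM ⟨0, hn⟩)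
  have hMr : (1 : ℝ) ≤ M := by exact_mod_cast hM1
  have hnr : (1 : ℝ) ≤ n := by exact_mod_cast hn
  obtain ⟨η, hη⟩ : ∃ η : ℝ, η = ε ^ (M + 1) / (n * M) := ⟨_, rfl⟩
  have hη0 : 0 < η := by rw [hη]; positivity
  have hηn : n * M * η = ε ^ (M + 1) := by rw [hη]; field_simp
  have hη1 : η ≤ 1 := by
    have h1 : ε ^ (M + 1) ≤ 1 := pow_le_one₀ hε0.le hε1
    have h2 : (1 : ℝ) ≤ n * M := by nlinarith
    nlinarith
  have hsmall : ∀ᶠ r in 𝓝[>] (0 : ℝ), ∀ i k : Fin n, ν i < ν k →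
      (n * (|t k| * C ^ ν k / η ^ M)) * r ^ ν k ≤ (|t i| * (c / M) ^ ν i) * r ^ ν i := by
    rw [eventually_all]; intro i
    rw [eventually_all]; intro k
    rw [eventually_imp_distrib_left]; intro hik
    have := abs_pos.2 (ht i)
    have := abs_pos.2 (ht k)
    exact small_pow hik (by positivity) (by positivity)
  filter_upwards [hsmall, self_mem_nhdsWithin] with r hr hr0 y hy hF
  have hr0 : 0 < r := hr0
  obtain ⟨T, hT⟩ : ∃ T : Fin n → ℝ, T = fun j => t j * y j ^ ν j := ⟨_, rfl⟩
  have hsum : ∑ j, T j < 0 := by rw [hT]; exact hF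
  have : Nonempty (Fin n) := ⟨⟨0, hn⟩⟩
  obtain ⟨k, hk⟩ := Finite.exists_max (fun j => -T j / η ^ ν j)
  have hTk : T k < 0 := by
    obtain ⟨j, -, hj⟩ : ∃ j ∈ Finset.univ, T j < 0 := by
      by_contra! hcon
      exact absurd hsum (not_lt.2 (Finset.sum_nonneg hcon))
    have h1 : 0 < -T j / η ^ ν j := div_pos (by linarith) (by positivity)
    have h2 := h1.trans_le (hk j)
    have h3 : 0 < -T k := by
      by_contra! hcon
      exact absurd h2 (not_lt.2 (div_nonpos_of_nonpos_of_nonneg hcon (by positivity)))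
    linarith
  have hk' : ∀ j, -T j ≤ η ^ ν j * (-T k / η ^ ν k) := by
    intro j
    have := hk j
    rw [div_le_iff₀ (by positivity)] at this
    linarith
  have hTk' : 0 < -T k := by linarith
  have hdom : ∀ j, ν k < ν j → -T j ≤ η * (-T k) := by
    intro j hj
    refine (hk' j).trans ?_
    have : η ^ ν j ≤ η ^ (ν k + 1) := pow_le_pow_of_le_one hη0.le hη1 hj
    calc η ^ ν j * (-T k / η ^ ν k) ≤ η ^ (ν k + 1) * (-T k / η ^ ν k) := by gcongr
      _ = η * (-T k) := by rw [pow_succ]; field_simp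
  have hbd : ∀ j, -T j ≤ -T k / η ^ M := by
    intro j
    refine (hk' j).trans ?_
    have h1 : η ^ ν j ≤ 1 := pow_le_one₀ hη0.le hη1
    have h2 : η ^ M ≤ η ^ ν k := pow_le_pow_of_le_one hη0.le hη1 (hM k)
    calc η ^ ν j * (-T k / η ^ ν k) ≤ 1 * (-T k / η ^ M) := by gcongr
      _ = _ := one_mul _
  have hTi : ∀ i, T i ≤ n * (-T k / η ^ M) := by
    intro i
    have h1 : T i + ∑ j ∈ Finset.univ.erase i, T j = ∑ j, T j :=
      Finset.add_sum_erase _ _ (Finset.mem_univ i)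
    have h2 : ∑ j ∈ Finset.univ.erase i, -T j ≤ ∑ j ∈ Finset.univ.erase i, (-T k / η ^ M) :=
      Finset.sum_le_sum fun j _ => hbd j
    rw [Finset.sum_neg_distrib, Finset.sum_const, nsmul_eq_mul] at h2
    have h3 : ((Finset.univ.erase i).card : ℝ) ≤ n := by
      have := Finset.card_erase_le (s := (Finset.univ : Finset (Fin n))) (a := i)
      rw [Finset.card_univ, Fintype.card_fin] at this
      exact_mod_cast this
    have h4 : 0 ≤ -T k / η ^ M := by positivity
    nlinarith
  have htiny : ∀ i, 0 < T i → ν i < ν k → M * |y i| ≤ c * r := by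
    intro i hi hik
    by_contra! hcon
    have h1 : c / M * r < |y i| := by
      rw [div_mul_eq_mul_div, div_lt_iff₀ (by positivity)]; linarith
    have h2 : (c / M * r) ^ ν i < |y i| ^ ν i :=
      pow_lt_pow_left₀ h1 (by positivity) (by have := hν i; omega)
    have h3 : T i = |t i| * |y i| ^ ν i := by
      rw [← abs_of_pos hi, hT]; simp only [abs_mul, abs_pow]
    have h4 : -T k = |t k| * |y k| ^ ν k := by
      rw [← abs_of_neg hTk, hT]; simp only [abs_mul, abs_pow]
    have h5 : |y k| ^ ν k ≤ (C * r) ^ ν k := by gcongr; exact hy k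
    have h6 := hTi i
    have h7 := hr i k hik
    have h8 : (n : ℝ) * (-T k / η ^ M) ≤ n * (|t k| * C ^ ν k / η ^ M) * r ^ ν k := by
      rw [h4]
      calc (n : ℝ) * (|t k| * |y k| ^ ν k / η ^ M) ≤ n * (|t k| * (C * r) ^ ν k / η ^ M) := by gcongr
        _ = _ := by rw [mul_pow]; ring
    have h9 : |t i| * (c / M) ^ ν i * r ^ ν i < T i := by
      rw [h3, mul_assoc, ← mul_pow]
      exact mul_lt_mul_of_pos_left h2 (abs_pos.2 (ht i))
    linarith
  refine ⟨fun x j => (if j = k then 1 - (1 - ε) * ((1 - ε) * x) else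
      if 0 < T j ∧ ν j < ν k then (1 - (1 - ε) * x) ^ M else 1 - (1 - ε) * x) * y j, ?_, ?_, ?_, ?_⟩
  · refine continuous_pi fun j => ?_
    split_ifs <;> fun_prop
  · funext j; simp
  · intro j
    have hyj := hy j
    simp only [mul_one, abs_mul]
    have h1 : |(if j = k then 1 - (1 - ε) * (1 - ε) else
      if 0 < T j ∧ ν j < ν k then (1 - (1 - ε)) ^ M else 1 - (1 - ε))| ≤ 2 * ε := by
      split_ifs
      · rw [abs_of_nonneg (by nlinarith)]; nlinarith
      · have h : 1 - (1 - ε) = ε := by ring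
        rw [h, abs_of_nonneg (by positivity)]
        have := pow_le_pow_of_le_one hε0.le hε1 hM1
        rw [pow_one] at this
        linarith
      · rw [abs_of_nonneg (by linarith)]; linarith
    calc _ ≤ (2 * ε) * (C * r) := by gcongr
      _ = (2 * ε * C) * r := by ring
      _ ≤ c * r := by gcongr
  · intro x hx0 hx1
    have hτ0 : 0 ≤ (1 - ε) * x := mul_nonneg (by linarith) hx0
    have hτ1 : (1 - ε) * x ≤ 1 - ε := by nlinarith
    beta_reduce
    generalize (1 - ε) * x = τ at hτ0 hτ1 ⊢
    constructor
    · have := sum_est hν hM hε0 hε1 hη0 hηn hTk hdom hsum hτ0 hτ1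
      refine lt_of_eq_of_lt ?_ this
      refine Finset.sum_congr rfl fun j _ => ?_
      rw [mul_pow, mul_left_comm, hT]
    · have hz : ∀ j, ∃ z : ℝ, |z| ≤ c * r ∧ (if j = k then 1 - (1 - ε) * τ else
          if 0 < T j ∧ ν j < ν k then (1 - τ) ^ M else 1 - τ) * y j = (1 - τ) * y j + τ * z := by
        intro j
        split_ifs with h1 h2
        · refine ⟨ε * y j, ?_, by ring⟩
          rw [abs_mul, abs_of_pos hε0]
          calc ε * |y j| ≤ ε * (C * r) := by gcongr; exact hy j
            _ = (ε * C) * r := by ring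
            _ ≤ c * r := by gcongr; nlinarith [mul_pos hε0 hC]
        · rcases hτ0.eq_or_lt with h | h
          · refine ⟨0, by simp; positivity, by rw [← h]; simp⟩
          · refine ⟨((1 - τ) ^ M - (1 - τ)) / τ * y j, ?_, by field_simp; ring⟩
            rw [abs_mul]
            refine le_trans ?_ (htiny j h2.1 h2.2)
            gcongr
            rw [abs_div, abs_of_pos h, div_le_iff₀ h, abs_le]
            have hb := bern (b := 1 - τ) (by linarith) M
            have hb2 := pow_le_pow_of_le_one (a := 1 - τ) (by linarith) (by linarith) hM1
            rw [pow_one] at hb2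
            constructor
            · nlinarith
            · nlinarith
        · exact ⟨0, by simp; positivity, by simp⟩
      choose z hz1 hz2 using hz
      exact ⟨τ, z, hτ0, by linarith, hz1, hz2⟩

set_option maxHeartbeats 4000000 in
/-- With the degenerate normal form of Statement 5 at `s`, if either at least
one `ν_i` is odd, or all `ν_i` are even and at least two `t_i` are negative, then for every
small `r > 0` the set `B(s,r) ∩ {W < W s}` is nonempty and connected. -/
theorem stmt6 (n : ℕ) (hn : 1 ≤ n) (W : EuclideanSpace ℝ (Fin n) → ℝ)
    (hW : ContDiff ℝ (⊤ : ℕ∞) W) (s : EuclideanSpace ℝ (Fin n))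
    (𝒱 : Set (EuclideanSpace ℝ (Fin n))) (h𝒱 : IsOpen 𝒱) (hs : s ∈ 𝒱)
    (U Uinv : EuclideanSpace ℝ (Fin n) → EuclideanSpace ℝ (Fin n))
    (hU : ContDiffOn ℝ (⊤ : ℕ∞) U 𝒱) (hUs : U s = s)
    (hUinj : Set.InjOn U 𝒱) (hUopen : IsOpen (U '' 𝒱))
    (hUinv : ContDiffOn ℝ (⊤ : ℕ∞) Uinv (U '' 𝒱))
    (hUinv' : ∀ x ∈ 𝒱, Uinv (U x) = x)
    (dU : EuclideanSpace ℝ (Fin n) ≃L[ℝ] EuclideanSpace ℝ (Fin n))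
    (hdU : HasFDerivAt U (dU : EuclideanSpace ℝ (Fin n) →L[ℝ] EuclideanSpace ℝ (Fin n)) s)
    (t : Fin n → ℝ) (ht : ∀ i, t i ≠ 0)
    (ν : Fin n → ℕ) (hν : ∀ i, 2 ≤ ν i)
    (hnf : ∀ x ∈ 𝒱, W (U x) - W s = ∑ i, t i * (x i - s i) ^ (ν i))
    (hcase : (∃ i, Odd (ν i)) ∨
      ((∀ i, Even (ν i)) ∧ ∃ i j : Fin n, i ≠ j ∧ t i < 0 ∧ t j < 0)) :
    ∃ r₀ > 0, ∀ r : ℝ, 0 < r → r < r₀ →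
      IsConnected (Metric.ball s r ∩ {x : EuclideanSpace ℝ (Fin n) | W x < W s}) := by
  
  have hsU : s ∈ U '' 𝒱 := ⟨s, hs, hUs⟩
  have hUinvs : Uinv s = s := by have := hUinv' s hs; rwa [hUs] at this
  -- the inverse is Lipschitz at `s`
  have hVd : DifferentiableAt ℝ Uinv s :=
    ((hUinv s hsU).contDiffAt (hUopen.mem_nhds hsU)).differentiableAt (by simp)
  obtain ⟨C, hC, hCb⟩ := hVd.hasFDerivAt.isBigO_sub.exists_pos
  rw [Asymptotics.isBigOWith_iff] at hCb
  -- strict differentiability of `U`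
  have hUst : HasStrictFDerivAt U
      (dU : EuclideanSpace ℝ (Fin n) →L[ℝ] EuclideanSpace ℝ (Fin n)) s :=
    ((hU s hs).contDiffAt (h𝒱.mem_nhds hs)).hasStrictFDerivAt' hdU (by simp)
  obtain ⟨A, hA0, hA⟩ : ∃ A : ℝ, 0 ≤ A ∧ ∀ x, ‖dU x‖ ≤ A * ‖x‖ :=
    ⟨‖(dU : EuclideanSpace ℝ (Fin n) →L[ℝ] EuclideanSpace ℝ (Fin n))‖, norm_nonneg _,
      fun x => (dU : EuclideanSpace ℝ (Fin n) →L[ℝ] EuclideanSpace ℝ (Fin n)).le_opNorm x⟩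
  let e := (EuclideanSpace.equiv (Fin n) ℝ).symm
  have he : ∀ z i, (e z) i = z i := fun z i => rfl
  obtain ⟨D, hD0, hD⟩ : ∃ D : ℝ, 0 ≤ D ∧ ∀ z, ‖e z‖ ≤ D * ‖z‖ :=
    ⟨‖(e : (Fin n → ℝ) →L[ℝ] EuclideanSpace ℝ (Fin n))‖, norm_nonneg _,
      fun x => (e : (Fin n → ℝ) →L[ℝ] EuclideanSpace ℝ (Fin n)).le_opNorm x⟩
  obtain ⟨c, hcdef⟩ : ∃ c : ℝ, c = 1 / (4 * (A + 1) * (D + 1)) := ⟨_, rfl⟩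
  have hc : 0 < c := by rw [hcdef]; positivity
  have hcAD : c * (4 * (A + 1) * (D + 1)) = 1 := by rw [hcdef]; field_simp
  obtain ⟨δ, hδdef⟩ : ∃ δ : ℝ, δ = 1 / (8 * (C + 1)) := ⟨_, rfl⟩
  have hδ : 0 < δ := by rw [hδdef]; positivity
  have hδC : δ * (8 * (C + 1)) = 1 := by rw [hδdef]; field_simp
  have hbracket : A * (D * c) + δ * C + δ * (D * c + C) < 1 := by
    have h1 : A * (D * c) ≤ 1 / 4 := by nlinarith [mul_nonneg hA0 hc.le, mul_nonneg hD0 hc.le]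
    have h2 : δ * C ≤ 1 / 8 := by nlinarith
    have h3 : D * c ≤ 1 / 4 := by
      nlinarith [mul_nonneg hA0 hc.le, mul_nonneg hD0 hc.le, mul_nonneg hD0 (mul_nonneg hA0 hc.le)]
    have h4 : δ ≤ 1 / 8 := by nlinarith [mul_pos hδ hC]
    nlinarith
  have hst := hUst.isLittleO.def hδ
  rw [Metric.eventually_nhds_iff_ball] at hst
  obtain ⟨ρ₁, hρ₁, hst⟩ := hst
  obtain ⟨ρ₂, hρ₂, hball⟩ := Metric.isOpen_iff.1 h𝒱 s hs
  obtain ⟨ρ, hρ, hρ1, hρ2⟩ : ∃ ρ > 0, ρ ≤ ρ₁ ∧ ρ ≤ ρ₂ :=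
    ⟨min ρ₁ ρ₂, lt_min hρ₁ hρ₂, min_le_left _ _, min_le_right _ _⟩
  have hR : ∀ u v : EuclideanSpace ℝ (Fin n), ‖u‖ < ρ → ‖v‖ < ρ →
      ‖U (s + u) - U (s + v) - dU (u - v)‖ ≤ δ * ‖u - v‖ := by
    intro u v hu hv
    have := hst (s + u, s + v) (by
      rw [Metric.mem_ball, Prod.dist_eq]
      simp only [dist_self_add_left]
      exact max_lt (hu.trans_le hρ1) (hv.trans_le hρ1))
    simpa using this
  have hmem : ∀ u : EuclideanSpace ℝ (Fin n), ‖u‖ < ρ → s + u ∈ 𝒱 := fun u hu =>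
    hball (by rw [Metric.mem_ball, dist_self_add_left]; exact hu.trans_le hρ2)
  obtain ⟨ρ₃, hρ₃, hCb⟩ := Metric.eventually_nhds_iff_ball.1 hCb
  obtain ⟨ρ₄, hρ₄, hUball⟩ := Metric.isOpen_iff.1 hUopen s hsU
  have hcon := contraction hn ht hν hc hC
  obtain ⟨ρ₅, hρ₅, hcon⟩ := mem_nhdsGT_iff_exists_Ioo_subset.1 hcon
  have hρ₅ : 0 < ρ₅ := hρ₅
  have hWF : ∀ z : Fin n → ℝ, ‖e z‖ < ρ → (W (U (s + e z)) < W s ↔ FF t ν z < 0) := by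
    intro z hz
    have := hnf _ (hmem _ hz)
    have h2 : FF t ν z = W (U (s + e z)) - W s := by
      rw [this]; refine Finset.sum_congr rfl fun i _ => ?_
      rw [PiLp.add_apply, he]; ring
    rw [h2, sub_neg]
  refine ⟨min (min ρ₃ ρ₄) (min ρ₅ (min (ρ / (C + 1)) (ρ / (D * c + 1)))), by positivity, ?_⟩
  intro r hr0 hr
  simp only [lt_min_iff] at hr
  obtain ⟨⟨hr3, hr4⟩, hr5, hr6, hr7⟩ := hr
  rw [lt_div_iff₀ (by positivity)] at hr6 hr7
  have hcr : 0 < c * r := by positivity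
  have hbox : ∀ z : Fin n → ℝ, (∀ i, |z i| ≤ c * r) → ‖e z‖ ≤ D * c * r := by
    intro z hz
    have : ‖z‖ ≤ c * r := (pi_norm_le_iff_of_nonneg hcr.le).2 hz
    calc ‖e z‖ ≤ D * ‖z‖ := hD z
      _ ≤ D * (c * r) := by gcongr
      _ = _ := by ring
  -- star property
  have hstar : ∀ u z : EuclideanSpace ℝ (Fin n), ‖u‖ ≤ C * r → ‖z‖ ≤ D * c * r →
      ‖U (s + u) - s‖ < r → ∀ τ : ℝ, 0 ≤ τ → τ ≤ 1 →
      ‖(1 - τ) • u + τ • z‖ < ρ ∧ ‖U (s + ((1 - τ) • u + τ • z)) - s‖ < r := by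
    intro u z hu hz hUu τ h0 h1
    have huρ : ‖u‖ < ρ := by linarith
    have hzρ : ‖z‖ < ρ := by linarith
    have hw : ‖(1 - τ) • u + τ • z‖ < ρ := by
      have := (convex_ball (0 : EuclideanSpace ℝ (Fin n)) ρ)
        (mem_ball_zero_iff.2 huρ) (mem_ball_zero_iff.2 hzρ) (sub_nonneg.2 h1) h0 (by ring)
      exact mem_ball_zero_iff.1 this
    refine ⟨hw, ?_⟩
    have e1 := hR _ _ hw huρ
    have e2 := hR u 0 huρ (by simpa using hρ)
    rw [add_zero, hUs, sub_zero] at e2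
    have hdiff : (1 - τ) • u + τ • z - u = τ • (z - u) := by module
    rw [hdiff, map_smul, norm_smul, Real.norm_of_nonneg h0, map_sub] at e1
    have e3 : ‖z - u‖ ≤ D * c * r + C * r := (norm_sub_le _ _).trans (add_le_add hz hu)
    have e4 : ‖dU z‖ ≤ A * (D * c * r) := (hA z).trans (by gcongr)
    have hid : U (s + ((1 - τ) • u + τ • z)) - s = (1 - τ) • (U (s + u) - s)
        + τ • (dU z + (U (s + u) - s - dU u))
        + (U (s + ((1 - τ) • u + τ • z)) - U (s + u) - τ • (dU z - dU u)) := by module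
    have e5 : ‖dU z + (U (s + u) - s - dU u)‖ ≤ A * (D * c * r) + δ * (C * r) :=
      (norm_add_le _ _).trans (add_le_add e4 (e2.trans (by gcongr)))
    have e6 : ‖U (s + ((1 - τ) • u + τ • z)) - s‖ ≤ (1 - τ) * ‖U (s + u) - s‖
        + τ * (A * (D * c * r) + δ * (C * r)) + δ * (τ * (D * c * r + C * r)) := by
      rw [hid]
      refine (norm_add₃_le).trans ?_
      rw [norm_smul, norm_smul, Real.norm_of_nonneg h0, Real.norm_of_nonneg (sub_nonneg.2 h1)]
      gcongr
      exact e1.trans (by gcongr)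
    have e7 : τ * (A * (D * c * r) + δ * (C * r)) + δ * (τ * (D * c * r + C * r))
        = τ * ((A * (D * c) + δ * C + δ * (D * c + C)) * r) := by ring
    have e8 : (A * (D * c) + δ * C + δ * (D * c + C)) * r < r := by nlinarith
    have e9 : (1 - τ) * ‖U (s + u) - s‖
        + τ * ((A * (D * c) + δ * C + δ * (D * c + C)) * r) < r := by
      rcases h0.eq_or_lt with h | h
      · rw [← h]; simpa using hUu
      · nlinarith [mul_lt_mul_of_pos_left e8 h, mul_nonneg (sub_nonneg.2 h1) (sub_nonneg.2 hUu.le)]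
    linarith
  have hboxT : ∀ z : Fin n → ℝ, (∀ i, |z i| ≤ c * r) → ‖e z‖ < ρ ∧ ‖U (s + e z) - s‖ < r := by
    intro z hz
    have := hstar 0 (e z) (by simp; positivity) (hbox z hz) (by simpa [hUs] using hr0) 1
      zero_le_one le_rfl
    simpa using this
  have hcontU : ∀ z : Fin n → ℝ, ‖e z‖ < ρ → ContinuousAt (fun z => U (s + e z)) z := by
    intro z hz
    have h1 : ContinuousAt U (s + e z) :=
      hU.continuousOn.continuousAt (h𝒱.mem_nhds (hmem _ hz))
    have h2 : ContinuousAt (fun z => s + e z) z :=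
      (continuous_const.add e.continuous).continuousAt
    exact ContinuousAt.comp (f := fun z => s + e z) h1 h2
  have hPC := boxNeg_pathConnected ht hν hcase hcr
  have hsub : (fun z => U (s + e z)) '' (boxNeg t ν (c * r)) ⊆
      Metric.ball s r ∩ {x : EuclideanSpace ℝ (Fin n) | W x < W s} := by
    rintro _ ⟨z, ⟨hz, hzF⟩, rfl⟩
    obtain ⟨h1, h2⟩ := hboxT z hz
    exact ⟨by rw [Metric.mem_ball, dist_eq_norm]; exact h2, (hWF z h1).2 hzF⟩
  have hcontB : ContinuousOn (fun z => U (s + e z)) (boxNeg t ν (c * r)) := fun z hz =>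
    (hcontU z (hboxT z hz.1).1).continuousWithinAt
  obtain ⟨p, hp, hpj⟩ := hPC
  refine IsPathConnected.isConnected ⟨U (s + e p), hsub ⟨p, hp, rfl⟩, fun {x} hx => ?_⟩
  obtain ⟨hxb, hxW⟩ := hx
  have hxW : W x < W s := hxW
  obtain ⟨y', hy', rfl⟩ := hUball (Metric.ball_subset_ball hr4.le hxb)
  have hy'C : ‖y' - s‖ ≤ C * r := by
    have := hCb _ (Metric.ball_subset_ball hr3.le hxb)
    rw [hUinv' y' hy', hUinvs] at this
    rw [Metric.mem_ball, dist_eq_norm] at hxb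
    exact this.trans (by gcongr)
  obtain ⟨y, hy⟩ : ∃ y : Fin n → ℝ, e y = y' - s :=
    ⟨EuclideanSpace.equiv (Fin n) ℝ (y' - s), ContinuousLinearEquiv.symm_apply_apply _ _⟩
  obtain rfl : y' = s + e y := by rw [hy]; abel
  rw [add_sub_cancel_left] at hy'C
  have hyρ : ‖e y‖ < ρ := by linarith
  have hyF := (hWF y hyρ).1 hxW
  have hyb : ∀ i, |y i| ≤ C * r := fun i => by
    have := PiLp.norm_apply_le (e y) i
    rw [he, Real.norm_eq_abs] at this
    exact this.trans hy'C
  obtain ⟨γ, hγc, hγ0, hγ1, hγ⟩ := hcon ⟨hr0, hr5⟩ y hyb hyF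
  rw [Metric.mem_ball, dist_eq_norm] at hxb
  have hγ' : ∀ x : ℝ, 0 ≤ x → x ≤ 1 → ‖e (γ x)‖ < ρ ∧ ‖U (s + e (γ x)) - s‖ < r := by
    intro x hx0 hx1
    obtain ⟨-, τ, z, h0, h1, hz, hzγ⟩ := hγ x hx0 hx1
    have : e (γ x) = (1 - τ) • e y + τ • e z := by
      rw [← map_smul, ← map_smul, ← map_add]
      congr 1; funext i; simpa using hzγ i
    rw [this]
    exact hstar _ _ hy'C (hbox z hz) hxb τ h0 h1
  have J1 : JoinedIn (Metric.ball s r ∩ {x : EuclideanSpace ℝ (Fin n) | W x < W s})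
      (U (s + e y)) (U (s + e (γ 1))) := by
    refine JoinedIn.ofLine (f := fun x => U (s + e (γ x))) ?_ (by simp only [hγ0]) rfl ?_
    · intro x hx
      exact (ContinuousAt.comp (f := γ) (hcontU _ (hγ' x hx.1 hx.2).1)
        hγc.continuousAt).continuousWithinAt
    · rintro _ ⟨x, hx, rfl⟩
      obtain ⟨h1, h2⟩ := hγ' x hx.1 hx.2
      exact ⟨by rw [Metric.mem_ball, dist_eq_norm]; exact h2,
        (hWF _ h1).2 (hγ x hx.1 hx.2).1⟩
  have J2 := ((hpj (y := γ 1) ⟨hγ1, (hγ 1 zero_le_one le_rfl).1⟩).map_continuousOn hcontB).mono hsub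
  exact J2.trans J1.symm
end

section
/- Let n ≥ 1, let ν₁,…,ν_n be positive integers, and for each i let r_i : ℝ^n → ℝ be a C^∞ function with r_i(0) = 0. On the open neighborhood of 0 where 1 + r_i(x) > 0 for all i, define φ(x) = (x₁(1+r₁(x))^{1/ν₁}, …, x_n(1+r_n(x))^{1/ν_n}). Then φ is C^∞ near 0, its differential at 0 is the identity map of ℝ^n, and consequently there exist open neighborhoods 𝒰 and 𝒲 of 0 such that φ restricts to a C^∞ diffeomorphism from 𝒰 onto 𝒲. -/
/-- Let `ν_1, …, ν_n` be positive integers and `r_i : ℝ^n → ℝ` be `C^∞`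
functions with `r_i 0 = 0`. Define `φ x = (x_1 (1+r_1 x)^{1/ν_1}, …, x_n (1+r_n x)^{1/ν_n})`
(real powers). Then `φ` is `C^∞` near `0`, its differential at `0` is the identity, and there
exist open neighborhoods `𝒰, 𝒲` of `0` such that `φ` restricts to a `C^∞` diffeomorphism from
`𝒰` onto `𝒲`. -/
theorem stmt7 (n : ℕ) (hn : 1 ≤ n) (ν : Fin n → ℕ) (hν : ∀ i, 0 < ν i)
    (r : Fin n → (Fin n → ℝ) → ℝ) (hr : ∀ i, ContDiff ℝ (⊤ : ℕ∞) (r i))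
    (hr0 : ∀ i, r i 0 = 0)
    (φ : (Fin n → ℝ) → (Fin n → ℝ))
    (hφdef : φ = fun x i => x i * (1 + r i x) ^ ((ν i : ℝ)⁻¹)) :
    ContDiffAt ℝ (⊤ : ℕ∞) φ 0 ∧
    HasFDerivAt φ (ContinuousLinearMap.id ℝ (Fin n → ℝ)) 0 ∧
    ∃ 𝒰 𝒲 : Set (Fin n → ℝ), IsOpen 𝒰 ∧ IsOpen 𝒲 ∧ (0 : Fin n → ℝ) ∈ 𝒰 ∧
      (0 : Fin n → ℝ) ∈ 𝒲 ∧ Set.BijOn φ 𝒰 𝒲 ∧ ContDiffOn ℝ (⊤ : ℕ∞) φ 𝒰 ∧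
      ∃ ψ : (Fin n → ℝ) → (Fin n → ℝ),
        ContDiffOn ℝ (⊤ : ℕ∞) ψ 𝒲 ∧ ∀ x ∈ 𝒰, ψ (φ x) = x := by
  have hP : IsOpen {x : Fin n → ℝ | ∀ i, 0 < 1 + r i x} := by
    rw [Set.setOf_forall]
    exact isOpen_iInter_of_finite fun i =>
      isOpen_lt continuous_const (continuous_const.add (hr i).continuous)
  have hC : ∀ x ∈ {x : Fin n → ℝ | ∀ i, 0 < 1 + r i x}, ContDiffAt ℝ (⊤ : ℕ∞) φ x := by
    intro x hx
    rw [hφdef, contDiffAt_pi]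
    intro i
    refine (contDiff_apply ℝ ℝ i).contDiffAt.mul ?_
    exact (contDiffAt_const.add (hr i).contDiffAt).rpow_const_of_ne (hx i).ne'
  have h0P : (0 : Fin n → ℝ) ∈ {x : Fin n → ℝ | ∀ i, 0 < 1 + r i x} := by
    intro i
    simp [hr0]
  have hD : HasFDerivAt φ (ContinuousLinearMap.id ℝ (Fin n → ℝ)) 0 := by
    rw [hφdef, hasFDerivAt_pi']
    intro i
    have h1 : HasFDerivAt (fun x : Fin n → ℝ => x i)
        (ContinuousLinearMap.proj (R := ℝ) (φ := fun _ : Fin n => ℝ) i) 0 := hasFDerivAt_apply i 0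
    have h2 : DifferentiableAt ℝ (fun x => (1 + r i x) ^ ((ν i : ℝ)⁻¹)) 0 :=
      ((contDiffAt_const.add (hr i).contDiffAt).rpow_const_of_ne (h0P i).ne').differentiableAt
        (n := (⊤ : ℕ∞)) (by simp)
    refine (h1.mul h2.hasFDerivAt).congr_fderiv ?_
    ext v
    simp [hr0]
  have hc0 := hC 0 h0P
  have hD' : HasFDerivAt φ
      ((ContinuousLinearEquiv.refl ℝ (Fin n → ℝ) : (Fin n → ℝ) ≃L[ℝ] (Fin n → ℝ)) :
        (Fin n → ℝ) →L[ℝ] (Fin n → ℝ)) 0 := hD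
  refine ⟨hc0, hD, ?_⟩
  let e := hc0.toOpenPartialHomeomorph φ hD' (by simp)
  have he : (e : (Fin n → ℝ) → (Fin n → ℝ)) = φ := rfl
  have h0e : (0 : Fin n → ℝ) ∈ e.source :=
    hc0.mem_toOpenPartialHomeomorph_source hD' (by simp)
  have hφ0 : φ 0 = 0 := by
    rw [hφdef]; ext i; simp
  have hcf : ContinuousOn (fderiv ℝ φ) {x : Fin n → ℝ | ∀ i, 0 < 1 + r i x} := by
    have hCo : ContDiffOn ℝ (⊤ : ℕ∞) φ {x : Fin n → ℝ | ∀ i, 0 < 1 + r i x} :=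
      fun x hx => (hC x hx).contDiffWithinAt
    exact hCo.continuousOn_fderiv_of_isOpen hP (by exact_mod_cast le_top)
  have hV := hcf.isOpen_inter_preimage hP
    (ContinuousLinearEquiv.isOpen (𝕜 := ℝ) (E := Fin n → ℝ) (F := Fin n → ℝ))
  let e' := e.restrOpen _ hV
  have he' : (e' : (Fin n → ℝ) → (Fin n → ℝ)) = φ := rfl
  have h0 : (0 : Fin n → ℝ) ∈ e'.source :=
    ⟨h0e, h0P, ContinuousLinearEquiv.refl ℝ _, hD'.fderiv.symm⟩
  refine ⟨e'.source, e'.target, e'.open_source, e'.open_target, h0, ?_, e'.bijOn, ?_,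
    e'.symm, ?_, fun x hx => e'.left_inv hx⟩
  · have := e'.map_source h0
    rwa [he', hφ0] at this
  · exact fun x hx => (hC x hx.2.1).contDiffWithinAt
  · intro y hy
    have hs := e'.map_target hy
    obtain ⟨-, hxP, L, hL⟩ := hs
    refine (e'.contDiffAt_symm hy (f₀' := L) ?_ (hC _ hxP)).contDiffWithinAt
    rw [hL]
    exact ((hC _ hxP).differentiableAt (by simp)).hasFDerivAt
end

section
/- Let d, d' ≥ 1, let Σ be an invertible real d'×d' matrix, let V : ℝ^d → ℝ, α : ℝ^d × ℝ^{d'} → ℝ^d, β : ℝ^d × ℝ^{d'} → ℝ^{d'} be C^∞, let h > 0 and set f(x,v) = V(x) + |Σv|². Define the operator L* on smooth functions u by −L*u = α·∇_x u + β·∇_v u + (div_x α + div_v β) u − ( hΔ_v u + 4ΣᵀΣv·∇_v u + 4 Tr(ΣᵀΣ) u ). Then for every (x,v) ∈ ℝ^d × ℝ^{d'}: L*(e^{−2f/h})(x,v) = (2/h) ( α(x,v)·∇_xV(x) + 2β(x,v)·ΣᵀΣv − (h/2)(div_x α + div_v β)(x,v) ) e^{−2f(x,v)/h}. In particular, L*(e^{−2f/h})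 vanishes identically if and only if α·∇_xV + 2β·ΣᵀΣv − (h/2)(div_x α + div_v β) = 0 identically on ℝ^d × ℝ^{d'}. -/
noncomputable section

/-- Points of the phase space `ℝ^d × ℝ^{d'}`. -/
abbrev KPt (d d' : ℕ) := (Fin d → ℝ) × (Fin d' → ℝ)

/-- Partial derivative of `g` in the `i`-th position variable. -/
noncomputable def pdX (d d' : ℕ) (g : KPt d d' → ℝ) (i : Fin d) (p : KPt d d') : ℝ :=
  fderiv ℝ (fun x => g (x, p.2)) p.1 (Pi.single i 1)

/-- Partial derivative of `g` in the `j`-th velocity variable. -/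
noncomputable def pdV (d d' : ℕ) (g : KPt d d' → ℝ) (j : Fin d') (p : KPt d d') : ℝ :=
  fderiv ℝ (fun v => g (p.1, v)) p.2 (Pi.single j 1)

/-- Divergence in the position variables. -/
noncomputable def divX (d d' : ℕ) (α : KPt d d' → Fin d → ℝ) (p : KPt d d') : ℝ :=
  ∑ i, pdX d d' (fun q => α q i) i p

/-- Divergence in the velocity variables. -/
noncomputable def divV (d d' : ℕ) (β : KPt d d' → Fin d' → ℝ) (p : KPt d d') : ℝ :=
  ∑ j, pdV d d' (fun q => β q j) j p

/-- Laplacian in the velocity variables. -/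
noncomputable def lapV (d d' : ℕ) (g : KPt d d' → ℝ) (p : KPt d d') : ℝ :=
  ∑ j, pdV d d' (fun q => pdV d d' g j q) j p

/-- `f(x,v) = V(x) + |Σv|²`. -/
noncomputable def fKFP (d d' : ℕ) (S : Matrix (Fin d') (Fin d') ℝ)
    (V : (Fin d → ℝ) → ℝ) (p : KPt d d') : ℝ :=
  V p.1 + ∑ j, (S.mulVec p.2 j) ^ 2

/-- The operator `L*` defined by
`−L*u = α·∇_x u + β·∇_v u + (div_x α + div_v β) u − (hΔ_v u + 4ΣᵀΣv·∇_v u + 4 Tr(ΣᵀΣ) u)`. -/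
noncomputable def Lstar (d d' : ℕ) (h : ℝ) (S : Matrix (Fin d') (Fin d') ℝ)
    (α : KPt d d' → Fin d → ℝ) (β : KPt d d' → Fin d' → ℝ)
    (u : KPt d d' → ℝ) (p : KPt d d') : ℝ :=
  -((∑ i, α p i * pdX d d' u i p) + (∑ j, β p j * pdV d d' u j p)
      + (divX d d' α p + divV d d' β p) * u p
      - (h * lapV d d' u p
          + 4 * (∑ j, (S.transpose * S).mulVec p.2 j * pdV d d' u j p)
          + 4 * (S.transpose * S).trace * u p))

theorem hasFDeriv_quad (d' : ℕ) (S : Matrix (Fin d') (Fin d') ℝ) (v : Fin d' → ℝ) (j : Fin d') :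
    ∃ L : (Fin d' → ℝ) →L[ℝ] ℝ,
      HasFDerivAt (fun v : Fin d' → ℝ => ∑ k, (S.mulVec v k) ^ 2) L v ∧
      L (Pi.single j 1) = 2 * (S.transpose * S).mulVec v j := by
  have h1 : ∀ k, HasFDerivAt (fun v : Fin d' → ℝ => S.mulVec v k)
      ((ContinuousLinearMap.proj k).comp (Matrix.mulVecLin S).toContinuousLinearMap) v := fun k =>
    ((ContinuousLinearMap.proj (R := ℝ) (φ := fun _ : Fin d' => ℝ) k).comp
      (Matrix.mulVecLin S).toContinuousLinearMap).hasFDerivAt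
  refine ⟨_, HasFDerivAt.fun_sum (fun k _ => (h1 k).pow 2), ?_⟩
  rw [← Matrix.mulVec_mulVec]
  simp only [ContinuousLinearMap.sum_apply, Matrix.mulVec, dotProduct, Matrix.transpose_apply]
  rw [Finset.mul_sum]
  refine Finset.sum_congr rfl fun k _ => ?_
  simp [Matrix.mulVec, dotProduct]
  ring

theorem hasFDeriv_lin (d' : ℕ) (M : Matrix (Fin d') (Fin d') ℝ) (v : Fin d' → ℝ) (j : Fin d') :
    ∃ L : (Fin d' → ℝ) →L[ℝ] ℝ,
      HasFDerivAt (fun v : Fin d' → ℝ => M.mulVec v j) L v ∧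
      L (Pi.single j 1) = M j j := by
  refine ⟨_, ((ContinuousLinearMap.proj (R := ℝ) (φ := fun _ : Fin d' => ℝ) j).comp
      (Matrix.mulVecLin M).toContinuousLinearMap).hasFDerivAt, ?_⟩
  simp

theorem pdV_exp (d d' : ℕ) (S : Matrix (Fin d') (Fin d') ℝ) (V : (Fin d → ℝ) → ℝ) (h : ℝ)
    (j : Fin d') (p : KPt d d') :
    pdV d d' (fun q => Real.exp (-2 * fKFP d d' S V q / h)) j p
      = -(4 / h) * (S.transpose * S).mulVec p.2 j * Real.exp (-2 * fKFP d d' S V p / h) := by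
  obtain ⟨L, hL, hLj⟩ := hasFDeriv_quad d' S p.2 j
  have h2 := (((hL.const_add (V p.1)).const_mul (-2)).mul_const h⁻¹).exp
  unfold pdV
  simp only [fKFP, div_eq_mul_inv]
  rw [h2.fderiv]
  simp [hLj]
  ring

theorem pdX_exp (d d' : ℕ) (S : Matrix (Fin d') (Fin d') ℝ) (V : (Fin d → ℝ) → ℝ) (h : ℝ)
    (hV : Differentiable ℝ V) (i : Fin d) (p : KPt d d') :
    pdX d d' (fun q => Real.exp (-2 * fKFP d d' S V q / h)) i p
      = -(2 / h) * fderiv ℝ V p.1 (Pi.single i 1) * Real.exp (-2 * fKFP d d' S V p / h) := by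
  have h2 := ((((hV p.1).hasFDerivAt.add_const (∑ j, (S.mulVec p.2 j) ^ 2)).const_mul
    (-2)).mul_const h⁻¹).exp
  unfold pdX
  simp only [fKFP, div_eq_mul_inv]
  rw [h2.fderiv]
  simp
  ring

theorem pdV_pdV_exp (d d' : ℕ) (S : Matrix (Fin d') (Fin d') ℝ) (V : (Fin d → ℝ) → ℝ) (h : ℝ)
    (j : Fin d') (p : KPt d d') :
    pdV d d' (fun q => pdV d d' (fun q => Real.exp (-2 * fKFP d d' S V q / h)) j q) j p
      = (-(4 / h) * (S.transpose * S) j j + (4 / h * (S.transpose * S).mulVec p.2 j) ^ 2)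
        * Real.exp (-2 * fKFP d d' S V p / h) := by
  simp only [pdV_exp]
  obtain ⟨L, hL, hLj⟩ := hasFDeriv_quad d' S p.2 j
  obtain ⟨M, hM, hMj⟩ := hasFDeriv_lin d' (S.transpose * S) p.2 j
  have h2 := (hM.const_mul (-(4 / h))).mul
    ((((hL.const_add (V p.1)).const_mul (-2)).mul_const h⁻¹).exp)
  unfold pdV
  simp only [fKFP, div_eq_mul_inv] at h2 ⊢
  erw [h2.fderiv]
  simp [hLj, hMj]
  ring

/-- For every `(x,v)`,
`L*(e^{−2f/h}) = (2/h)(α·∇_xV + 2β·ΣᵀΣv − (h/2)(div_x α + div_v β)) e^{−2f/h}`;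
in particular `L*(e^{−2f/h}) ≡ 0` iff
`α·∇_xV + 2β·ΣᵀΣv − (h/2)(div_x α + div_v β) ≡ 0`. -/
theorem stmt12 (d d' : ℕ) (hd : 1 ≤ d) (hd' : 1 ≤ d')
    (S : Matrix (Fin d') (Fin d') ℝ) (hS : IsUnit S)
    (V : (Fin d → ℝ) → ℝ) (hV : ContDiff ℝ (⊤ : ℕ∞) V)
    (α : KPt d d' → Fin d → ℝ) (hα : ContDiff ℝ (⊤ : ℕ∞) α)
    (β : KPt d d' → Fin d' → ℝ) (hβ : ContDiff ℝ (⊤ : ℕ∞) β)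
    (h : ℝ) (hh : 0 < h) :
    (∀ p : KPt d d',
      Lstar d d' h S α β (fun q => Real.exp (-2 * fKFP d d' S V q / h)) p
        = 2 / h *
            ((∑ i, α p i * fderiv ℝ V p.1 (Pi.single i 1))
              + 2 * (∑ j, β p j * (S.transpose * S).mulVec p.2 j)
              - h / 2 * (divX d d' α p + divV d d' β p)) *
            Real.exp (-2 * fKFP d d' S V p / h)) ∧
    ((∀ p : KPt d d',
        Lstar d d' h S α β (fun q => Real.exp (-2 * fKFP d d' S V q / h)) p = 0) ↔
      (∀ p : KPt d d',
        (∑ i, α p i * fderiv ℝ V p.1 (Pi.single i 1))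
          + 2 * (∑ j, β p j * (S.transpose * S).mulVec p.2 j)
          - h / 2 * (divX d d' α p + divV d d' β p) = 0)) := by
  have key : ∀ p : KPt d d',
      Lstar d d' h S α β (fun q => Real.exp (-2 * fKFP d d' S V q / h)) p
        = 2 / h *
            ((∑ i, α p i * fderiv ℝ V p.1 (Pi.single i 1))
              + 2 * (∑ j, β p j * (S.transpose * S).mulVec p.2 j)
              - h / 2 * (divX d d' α p + divV d d' β p)) *
            Real.exp (-2 * fKFP d d' S V p / h) := by
    intro p
    have hVd : Differentiable ℝ V := hV.differentiable (by simp)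
    have hh0 : h ≠ 0 := hh.ne'
    unfold Lstar lapV
    rw [Finset.sum_congr rfl fun j _ => pdV_pdV_exp d d' S V h j p]
    simp only [pdX_exp d d' S V h hVd, pdV_exp]
    generalize Real.exp (-2 * fKFP d d' S V p / h) = E
    generalize divX d d' α p + divV d d' β p = D
    have e1 : ∑ i, α p i * (-(2 / h) * fderiv ℝ V p.1 (Pi.single i 1) * E)
        = -(2 / h) * E * ∑ i, α p i * fderiv ℝ V p.1 (Pi.single i 1) := by
      rw [Finset.mul_sum]; exact Finset.sum_congr rfl fun _ _ => by ring
    have e2 : ∑ j, β p j * (-(4 / h) * (S.transpose * S).mulVec p.2 j * E)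
        = -(4 / h) * E * ∑ j, β p j * (S.transpose * S).mulVec p.2 j := by
      rw [Finset.mul_sum]; exact Finset.sum_congr rfl fun _ _ => by ring
    have e3 : ∑ j, (S.transpose * S).mulVec p.2 j * (-(4 / h) * (S.transpose * S).mulVec p.2 j * E)
        = -(4 / h) * E * ∑ j, (S.transpose * S).mulVec p.2 j ^ 2 := by
      rw [Finset.mul_sum]; exact Finset.sum_congr rfl fun _ _ => by ring
    have e4 : ∑ j, (-(4 / h) * (S.transpose * S) j j
          + (4 / h * (S.transpose * S).mulVec p.2 j) ^ 2) * E
        = -(4 / h) * E * (S.transpose * S).trace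
          + (4 / h) ^ 2 * E * ∑ j, (S.transpose * S).mulVec p.2 j ^ 2 := by
      rw [Matrix.trace, Finset.mul_sum, Finset.mul_sum, ← Finset.sum_add_distrib]
      exact Finset.sum_congr rfl fun _ _ => by rw [Matrix.diag_apply]; ring
    rw [e1, e2, e3, e4]
    field_simp
    ring
  refine ⟨key, forall_congr' fun p => ?_⟩
  rw [key p]
  have hne : (2 / h) ≠ 0 := by positivity
  simp only [mul_eq_zero, hne, (Real.exp_pos _).ne', false_or, or_false]
end
end

section
/- Let H be a complex Hilbert space, let D ⊆ H be a linear subspace, let P : D → H be a linear map, and let B : H → H be a bounded linear operator which is self-adjoint (⟨Bu, w⟩ = ⟨u, Bw⟩ for all u, w ∈ H). Let c > 0 and assume that for all u ∈ D, Re ⟨Pu, u + Bu⟩ ≥ c‖u‖². Then for every z ∈ ℂ with |Re z| ≤ c / (2(1 + ‖B‖)) and every u ∈ D, ‖Pu − zu‖ ≥ ( c / (2(1 + ‖B‖)) ) ‖u‖. -/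
/-- Let `H` be a complex Hilbert space, `D ⊆ H` a linear subspace,
`P : D → H` linear, and `B : H → H` a bounded self-adjoint operator. Let `c > 0` and assume
`Re ⟨Pu, u + Bu⟩ ≥ c‖u‖²` for all `u ∈ D`. Then for every `z ∈ ℂ` with
`|Re z| ≤ c/(2(1+‖B‖))` and every `u ∈ D`, `‖Pu − zu‖ ≥ (c/(2(1+‖B‖)))‖u‖`. -/
theorem stmt18 {H : Type*} [NormedAddCommGroup H] [InnerProductSpace ℂ H]
    [CompleteSpace H] (D : Submodule ℂ H) (P : D →ₗ[ℂ] H) (B : H →L[ℂ] H)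
    (hB : ∀ u w : H, inner (𝕜 := ℂ) (B u) w = inner (𝕜 := ℂ) u (B w))
    (c : ℝ) (hc : 0 < c)
    (hcoer : ∀ u : D, c * ‖(u : H)‖ ^ 2 ≤
      (inner (𝕜 := ℂ) (P u) ((u : H) + B (u : H))).re) :
    ∀ z : ℂ, |z.re| ≤ c / (2 * (1 + ‖B‖)) →
      ∀ u : D, c / (2 * (1 + ‖B‖)) * ‖(u : H)‖ ≤ ‖P u - z • (u : H)‖ := by
  intro z hz u
  have hM : 0 < 1 + ‖B‖ := by positivity
  set k := c / (2 * (1 + ‖B‖)) with hk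
  have hkM : k * (1 + ‖B‖) = c / 2 := by rw [hk]; field_simp
  have hv : ‖(u : H) + B u‖ ≤ (1 + ‖B‖) * ‖(u : H)‖ := by
    have h1 := norm_add_le (u : H) (B u)
    have h2 := B.le_opNorm (u : H)
    linarith
  have him : (inner ℂ (u : H) ((u : H) + B u)).im = 0 := by
    have h1 : (starRingEnd ℂ) (inner ℂ (u : H) ((u : H) + B u))
        = inner ℂ (u : H) ((u : H) + B u) := by
      rw [inner_conj_symm, inner_add_left, inner_add_right, hB]
    exact Complex.conj_eq_iff_im.mp h1
  have hr : |(inner ℂ (u : H) ((u : H) + B u)).re| ≤ (1 + ‖B‖) * ‖(u : H)‖ ^ 2 := by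
    have h1 := Complex.abs_re_le_norm (inner ℂ (u : H) ((u : H) + B u))
    have h2 := norm_inner_le_norm (𝕜 := ℂ) (u : H) ((u : H) + B u)
    have h3 := mul_le_mul_of_nonneg_left hv (norm_nonneg (u : H))
    linarith
  have hre : (inner ℂ (P u - z • (u : H)) ((u : H) + B u)).re
      = (inner ℂ (P u) ((u : H) + B u)).re - z.re * (inner ℂ (u : H) ((u : H) + B u)).re := by
    rw [inner_sub_left, inner_smul_left, Complex.sub_re, Complex.mul_re, him]
    rw [Complex.conj_re, mul_zero, sub_zero]
  have hup : (inner ℂ (P u - z • (u : H)) ((u : H) + B u)).re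
      ≤ ‖P u - z • (u : H)‖ * ((1 + ‖B‖) * ‖(u : H)‖) := by
    have h1 := Complex.re_le_norm (inner ℂ (P u - z • (u : H)) ((u : H) + B u))
    have h2 := norm_inner_le_norm (𝕜 := ℂ) (P u - z • (u : H)) ((u : H) + B u)
    have h3 := mul_le_mul_of_nonneg_left hv (norm_nonneg (P u - z • (u : H)))
    linarith
  have hzr : z.re * (inner ℂ (u : H) ((u : H) + B u)).re ≤ k * ((1 + ‖B‖) * ‖(u : H)‖ ^ 2) := by
    refine (le_abs_self _).trans ?_
    rw [abs_mul]
    exact mul_le_mul hz hr (abs_nonneg _) ((abs_nonneg _).trans hz)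
  have hc' := hcoer u
  rcases (norm_nonneg (u : H)).eq_or_lt with h0 | h0
  · rw [← h0, mul_zero]
    exact norm_nonneg _
  · refine le_of_mul_le_mul_right ?_ (mul_pos hM h0)
    have e1 : k * ((1 + ‖B‖) * ‖(u : H)‖ ^ 2) = c / 2 * ‖(u : H)‖ ^ 2 := by
      rw [← mul_assoc, hkM]
    have e2 : k * ‖(u : H)‖ * ((1 + ‖B‖) * ‖(u : H)‖) = c / 2 * ‖(u : H)‖ ^ 2 := by
      rw [← hkM]; ring
    linarith
end
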